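/- arXiv:2212.08357 — 4 statements merged into one kernel-verified Lean document; each statement's English description precedes it below -/
import Mathlib

section
/- Let G be a finite group and for n ≥ 1 define s(n) = |{(g₁,…,gₙ) ∈ Gⁿ : g₁²⋯gₙ² = 1}|. Then for every n ≥ 1, s(n)/|G|^{n-1} = ∑_{χ ∈ Irr(G)} ε(χ)ⁿ / χ(1)^{n-2}, where ε(χ) is the Frobenius–Schur indicator. -/
open CategoryTheory MonoidAlgebra
open scoped MonoidAlgebra

namespace FDRep

variable {G : Type} [Group G]

/-- **Schur's lemma**: a linear endomorphism commuting with a simple representation is a scalar. -/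
theorem exists_eq_smul_one_of_comm (V : FDRep ℂ G) [Simple V] (T : V →ₗ[ℂ] V)
    (hT : ∀ g, T * V.ρ g = V.ρ g * T) : ∃ c : ℂ, T = c • 1 := by
  let F : V ⟶ V := forget₂HomLinearEquiv V V
    (Rep.ofHom ⟨T, hT⟩)
  obtain ⟨c, hc⟩ := endomorphism_simple_eq_smul_id ℂ F
  exact ⟨c, LinearMap.ext fun v =>
    (ConcreteCategory.congr_hom (congrArg (fun f : V ⟶ V => f.hom) hc) v).symm⟩

theorem asAlgebraHom_ofModule' (W : Type) [AddCommGroup W] [Module ℂ W] [Module ℂ[G] W]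
    [IsScalarTower ℂ ℂ[G] W] (x : ℂ[G]) (w : W) :
    (Representation.ofModule' (k := ℂ) (G := G) W).asAlgebraHom x w = x • w := by
  simp [Representation.asAlgebraHom_def, Representation.ofModule']

theorem isIrreducible_ofModule' (W : Type) [AddCommGroup W] [Module ℂ W] [Module ℂ[G] W]
    [IsScalarTower ℂ ℂ[G] W] [IsSimpleModule ℂ[G] W] :
    (Representation.ofModule' (k := ℂ) (G := G) W).IsIrreducible := by
  let ρ := Representation.ofModule' (k := ℂ) (G := G) W
  let e : ρ.asModule ≃ₗ[ℂ[G]] W :=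
    { ρ.asModuleEquiv.toAddEquiv with
      map_smul' := fun x w => asAlgebraHom_ofModule' W x w }
  exact (Representation.irreducible_iff_isSimpleModule_asModule ρ).mpr (IsSimpleModule.congr e)

variable [Fintype G]

theorem sum_smul_ρ_comm (V : FDRep ℂ G) {f : G → ℂ} (hf : ∀ g h, f (h * g * h⁻¹) = f g) (h : G) :
    (∑ g, f g • V.ρ g) * V.ρ h = V.ρ h * ∑ g, f g • V.ρ g := by
  rw [Finset.sum_mul, Finset.mul_sum, ← Equiv.sum_comp (MulAut.conj h).toEquiv]
  refine Finset.sum_congr rfl fun g _ => ?_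
  simp [hf, ← map_mul]

theorem trace_sum_smul_ρ (V : FDRep ℂ G) (f : G → ℂ) :
    LinearMap.trace ℂ V (∑ g, f g • V.ρ g) = ∑ g, f g * V.character g := by
  simp [character]

theorem char_one_ne_zero (V : FDRep ℂ G) [Simple V] : V.character 1 ≠ 0 := by
  intro h
  have h0 : Module.finrank ℂ V = 0 := by simpa using h
  have := Module.finrank_zero_iff.mp h0
  have hV := (simple_iff_char_is_norm_one V).mp inferInstance
  have hz : ∀ g, V.character g = 0 := fun g => by
    rw [character, Subsingleton.elim (V.ρ g) 0, map_zero]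
  simp [hz, eq_comm] at hV

/-- A class function acts on a simple representation by a scalar. -/
theorem sum_smul_ρ_eq (V : FDRep ℂ G) [Simple V] {f : G → ℂ}
    (hf : ∀ g h, f (h * g * h⁻¹) = f g) :
    ∑ g, f g • V.ρ g = ((∑ g, f g * V.character g) / V.character 1) • 1 := by
  obtain ⟨c, hc⟩ := V.exists_eq_smul_one_of_comm _ (V.sum_smul_ρ_comm hf)
  rw [hc, ← trace_sum_smul_ρ, hc, map_smul, smul_eq_mul, LinearMap.trace_one, ← char_one,
    mul_div_cancel_right₀ _ V.char_one_ne_zero]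

theorem simple_of_isIrreducible {W : Type} [AddCommGroup W] [Module ℂ W] [FiniteDimensional ℂ W]
    (ρ : Representation ℂ G W) [ρ.IsIrreducible] : Simple (of ρ) := by
  have := invertibleOfNonzero (NeZero.ne (Nat.card G : ℂ))
  rw [simple_iff_char_is_norm_one]
  have h := Representation.char_orthonormal ρ ρ
  rw [if_pos ⟨Representation.Equiv.refl ρ⟩, inv_mul_eq_one₀ (NeZero.ne _)] at h
  exact h.symm

/-- A class function orthogonal to all irreducible characters vanishes. -/
theorem eq_zero_of_sum_mul_char_eq_zero {f : G → ℂ} (hf : ∀ g h, f (h * g * h⁻¹) = f g)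
    (h : ∀ (V : FDRep ℂ G) [Simple V], ∑ g, f g * V.character g = 0) : f = 0 := by
  let x : ℂ[G] := ∑ g, single g (f g)
  have hx : x = 0 := by
    rw [← Submodule.mem_bot ℂ[G], ← IsSemisimpleRing.jacobson_eq_bot ℂ[G]]
    refine Submodule.mem_sInf.mpr fun m hm => ?_
    have hs := isSimpleModule_iff_isCoatom.mpr hm
    have hρ := isIrreducible_ofModule' (G := G) (ℂ[G] ⧸ m)
    have hfin : Module.Finite ℂ (ℂ[G] ⧸ m) := Module.Finite.trans ℂ[G] _
    let ρ := Representation.ofModule' (k := ℂ) (G := G) (ℂ[G] ⧸ m)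
    have hV := simple_of_isIrreducible ρ
    have hact : ρ.asAlgebraHom x = 0 := by
      have := (of ρ).sum_smul_ρ_eq hf
      rw [h, zero_div, zero_smul] at this
      simpa [x] using this
    have h1 := asAlgebraHom_ofModule' (ℂ[G] ⧸ m) x (Submodule.Quotient.mk 1)
    rw [show (Representation.ofModule' (ℂ[G] ⧸ m)).asAlgebraHom x = 0 from hact,
      LinearMap.zero_apply, eq_comm, ← Submodule.Quotient.mk_smul,
      Submodule.Quotient.mk_eq_zero] at h1
    simpa using h1
  classical
  funext g
  simpa [x, Finsupp.single_apply] using congrArg (fun y : ℂ[G] => y.coeff g) hx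

variable {Irr : Finset (G → ℂ)}

/-- Column orthogonality with the column of the identity: `∑ χ(1) χ` is the regular character. -/
theorem sum_char_one_mul_char
    (hIrr : ∀ χ : G → ℂ, χ ∈ Irr ↔ ∃ V : FDRep ℂ G, Simple V ∧ V.character = χ) (g : G) :
    ∑ χ ∈ Irr, χ 1 * χ g = open scoped Classical in if g = 1 then (Fintype.card G : ℂ) else 0 := by
  classical
  have := invertibleOfNonzero (NeZero.ne (Nat.card G : ℂ))
  let f : G → ℂ := fun g =>
    ∑ χ ∈ Irr, χ 1 * χ g⁻¹ - if g = 1 then (Fintype.card G : ℂ) else 0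
  have hconj : ∀ g h, f (h * g * h⁻¹) = f g := by
    intro g h
    simp only [f, conj_eq_one_iff]
    congr 1
    refine Finset.sum_congr rfl fun χ hχ => ?_
    obtain ⟨V, -, rfl⟩ := (hIrr χ).mp hχ
    rw [mul_inv_rev, mul_inv_rev, inv_inv, ← mul_assoc, char_conj]
  have hf : f = 0 := by
    refine eq_zero_of_sum_mul_char_eq_zero hconj fun V hV => ?_
    have horth : ∀ χ ∈ Irr, ∑ g, χ g⁻¹ * V.character g =
        if χ = V.character then (Fintype.card G : ℂ) else 0 := by
      intro χ hχ
      obtain ⟨W, hW, rfl⟩ := (hIrr χ).mp hχ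
      split_ifs with heq
      · rw [heq, ← Nat.card_eq_fintype_card, ← (simple_iff_char_is_norm_one V).mp hV]
        simp only [mul_comm]
      · have h := char_orthonormal V W
        rw [if_neg fun ⟨i⟩ => heq (char_iso i).symm, mul_eq_zero_iff_left
          (inv_ne_zero (NeZero.ne _))] at h
        simpa only [mul_comm] using h
    have hmem : V.character ∈ Irr := (hIrr _).mpr ⟨V, hV, rfl⟩
    calc ∑ g, f g * V.character g
        = ∑ χ ∈ Irr, χ 1 * ∑ g, χ g⁻¹ * V.character g - Fintype.card G * V.character 1 := by
          simp only [f, sub_mul, Finset.sum_sub_distrib, Finset.sum_mul, Finset.mul_sum, mul_assoc]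
          rw [Finset.sum_comm]
          simp
      _ = 0 := by
          rw [Finset.sum_congr rfl fun χ hχ => by rw [horth χ hχ]]
          simp [hmem, mul_comm]
  have := congrFun hf g⁻¹
  simpa [f, sub_eq_zero] using this

/-- The character sum over products of `n` squares. -/
theorem sum_char_prod_sq (V : FDRep ℂ G) [Simple V] (n : ℕ) :
    ∑ v : Fin n → G, V.character ((List.ofFn v).map fun g => g ^ 2).prod =
      ((∑ g, V.character (g ^ 2)) / V.character 1) ^ n * V.character 1 := by
  have hcomm : ∀ h, (∑ g, V.ρ (g ^ 2)) * V.ρ h = V.ρ h * ∑ g, V.ρ (g ^ 2) := by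
    intro h
    rw [Finset.sum_mul, Finset.mul_sum, ← Equiv.sum_comp (MulAut.conj h).toEquiv]
    refine Finset.sum_congr rfl fun g _ => ?_
    rw [← map_mul, ← map_mul]
    simp [pow_two, mul_assoc]
  obtain ⟨c, hc⟩ := V.exists_eq_smul_one_of_comm _ hcomm
  have hc' : (∑ g, V.character (g ^ 2)) / V.character 1 = c := by
    have h := congrArg (LinearMap.trace ℂ V) hc
    rw [map_sum, map_smul, smul_eq_mul, LinearMap.trace_one, ← char_one] at h
    rw [div_eq_iff V.char_one_ne_zero, ← h]
    rfl
  have hpow : ∀ m : ℕ, ∑ v : Fin m → G, V.ρ ((List.ofFn v).map fun g => g ^ 2).prod =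
      (∑ g, V.ρ (g ^ 2)) ^ m := by
    intro m
    induction m with
    | zero => simp
    | succ m ih =>
      rw [← Equiv.sum_comp (Fin.consEquiv fun _ => G), Fintype.sum_prod_type, pow_succ', ← ih,
        Finset.sum_mul_sum]
      simp [List.ofFn_succ]
  rw [hc']
  calc _ = LinearMap.trace ℂ V (∑ v : Fin n → G, V.ρ ((List.ofFn v).map fun g => g ^ 2).prod) := by
        rw [map_sum]; rfl
    _ = c ^ n * V.character 1 := by
        rw [hpow, hc, smul_pow, one_pow, map_smul, smul_eq_mul, LinearMap.trace_one, char_one]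

end FDRep

/-- With `s(n)` the number of `n`-tuples `(g₁,…,gₙ)` with `g₁²⋯gₙ² = 1`, for every `n ≥ 1`,
`s(n)/|G|^{n-1} = ∑_{χ ∈ Irr(G)} ε(χ)ⁿ / χ(1)^{n-2}`. -/
theorem stmt_8 {G : Type} [Group G] [Fintype G] (Irr : Finset (G → ℂ))
    (hIrr : ∀ χ : G → ℂ, χ ∈ Irr ↔
      ∃ V : FDRep ℂ G, CategoryTheory.Simple V ∧ V.character = χ)
    (n : ℕ) (hn : 1 ≤ n) :
    (Nat.card {v : Fin n → G // ((List.ofFn v).map fun g => g ^ 2).prod = 1} : ℂ) /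
        (Fintype.card G : ℂ) ^ ((n : ℤ) - 1) =
      ∑ χ ∈ Irr, ((Fintype.card G : ℂ)⁻¹ * ∑ g : G, χ (g ^ 2)) ^ n /
        (χ 1) ^ ((n : ℤ) - 2) := by
  classical
  have hG : (Fintype.card G : ℂ) ≠ 0 := NeZero.ne _
  have hcount : (Nat.card {v : Fin n → G // ((List.ofFn v).map fun g => g ^ 2).prod = 1} : ℂ) *
      Fintype.card G = ∑ χ ∈ Irr, χ 1 * (((∑ g, χ (g ^ 2)) / χ 1) ^ n * χ 1) := by
    calc _ = ∑ v : Fin n → G, ∑ χ ∈ Irr, χ 1 * χ ((List.ofFn v).map fun g => g ^ 2).prod := by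
          simp only [FDRep.sum_char_one_mul_char hIrr]
          rw [Nat.card_eq_fintype_card, Fintype.card_subtype, Finset.sum_ite]
          simp
      _ = _ := by
          rw [Finset.sum_comm]
          refine Finset.sum_congr rfl fun χ hχ => ?_
          obtain ⟨V, hV, rfl⟩ := (hIrr χ).mp hχ
          rw [← Finset.mul_sum, V.sum_char_prod_sq n]
  rw [eq_div_of_mul_eq hG hcount, div_div, Finset.sum_div]
  refine Finset.sum_congr rfl fun χ hχ => ?_
  obtain ⟨V, hV, rfl⟩ := (hIrr χ).mp hχ
  have h1 := V.char_one_ne_zero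
  rw [← zpow_one_add₀ hG, add_sub_cancel, zpow_natCast, zpow_sub₀ h1, zpow_natCast, mul_pow,
    inv_pow, div_pow]
  field_simp
end

section
/- Let G be a finite group. The number of real-valued irreducible complex characters of G equals s(2)/|G|, where s(2) = |{(g,h) ∈ G² : g²h² = 1}|. -/
open scoped MonoidAlgebra ComplexConjugate

section Unitarian

open scoped ComplexOrder

variable {G V : Type*} [Group G] [Fintype G] [AddCommGroup V] [Module ℂ V] [FiniteDimensional ℂ V]

/-- Averaging `Aᴴ * A` over the group shows that matrix representations of a finite group are
unitarizable, so that inverting the group element conjugates the trace. -/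
theorem Matrix.trace_map_inv_eq_star {n : Type*} [Fintype n] [DecidableEq n]
    (A : G →* Matrix n n ℂ) (g : G) : (A g⁻¹).trace = star (A g).trace := by
  have inv_mul (h : G) : A h⁻¹ * A h = 1 := by rw [← map_mul, inv_mul_cancel, map_one]
  have mul_inv (h : G) : A h * A h⁻¹ = 1 := by rw [← map_mul, mul_inv_cancel, map_one]
  set P : Matrix n n ℂ := ∑ h, (A h).conjTranspose * A h with hP
  have hpos : P.PosDef := by
    refine Matrix.posDef_sum Finset.univ_nonempty fun h _ ↦ .conjTranspose_mul_self _ ?_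
    exact Matrix.mulVec_injective_of_isUnit (IsUnit.of_mul_eq_one _ (mul_inv h))
  have hinv : (A g).conjTranspose * P * A g = P := by
    rw [hP, Finset.mul_sum, Finset.sum_mul]
    refine Fintype.sum_equiv (Equiv.mulRight g) _ _ fun h ↦ ?_
    simp [Matrix.mul_assoc]
  obtain ⟨u, hu⟩ := hpos.isUnit
  have hconj : P * A g⁻¹ = (A g).conjTranspose * P := by
    rw [← hinv, Matrix.mul_assoc, mul_inv, hinv, mul_one]
  rw [← Matrix.trace_conjTranspose]
  have : (A g).conjTranspose = u * A g⁻¹ * (↑u⁻¹ : Matrix n n ℂ) := by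
    rw [hu, hconj, ← hu, Matrix.mul_assoc, Units.mul_inv, mul_one]
  rw [this, Matrix.trace_mul_comm, ← mul_assoc, Units.inv_mul, one_mul]

theorem Representation.character_inv_eq_star (ρ : Representation ℂ G V) (g : G) :
    ρ.character g⁻¹ = star (ρ.character g) := by
  let b := Module.finBasis ℂ V
  have key := Matrix.trace_map_inv_eq_star
    ((LinearMap.toMatrixAlgEquiv b).toMulEquiv.toMonoidHom.comp ρ) g
  simp only [Representation.character, LinearMap.trace_eq_matrix_trace ℂ b]
  exact key

end Unitarian

section Completeness

variable {k G : Type*} [Field k] [IsAlgClosed k] [CharZero k] [Group G] [Fintype G]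

/-- A class function orthogonal to the character of an irreducible representation acts as zero
on it. -/
theorem Representation.sum_smul_eq_zero_of_orthogonal {V : Type*} [AddCommGroup V] [Module k V]
    [FiniteDimensional k V] (ρ : Representation k G V) [ρ.IsIrreducible] {f : G → k}
    (hf : ∀ g h, f (h * g * h⁻¹) = f g) (horth : ∑ g, f g * ρ.character g⁻¹ = 0) :
    ∑ g, f g • ρ g⁻¹ = 0 := by
  set T : V →ₗ[k] V := ∑ g, f g • ρ g⁻¹ with hT
  have hcomm (h : G) : T ∘ₗ ρ h = ρ h ∘ₗ T := by
    change T * ρ h = ρ h * T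
    rw [hT, Finset.sum_mul, Finset.mul_sum]
    refine Fintype.sum_equiv (MulAut.conj h⁻¹).toEquiv _ _ fun g ↦ ?_
    simp only [MulEquiv.toEquiv_eq_coe, EquivLike.coe_coe, MulAut.conj_apply, hf, smul_mul_assoc,
      mul_smul_comm, ← map_mul]
    congr 2
    group
  obtain ⟨c, hc⟩ := (IsIrreducible.algebraMap_intertwiningMap_bijective_of_isAlgClosed
    (ρ := ρ)).surjective ⟨T, hcomm⟩
  have hTc : T = c • LinearMap.id := (congrArg IntertwiningMap.toLinearMap hc).symm
  have htr : LinearMap.trace k V T = 0 := by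
    rw [hT, map_sum]
    simpa [Representation.character] using horth
  have : Nontrivial V := by
    by_contra hV
    rw [not_nontrivial_iff_subsingleton] at hV
    obtain ⟨a, b, hab⟩ := exists_pair_ne (Subrepresentation ρ)
    exact hab (SetLike.ext fun x ↦ by
      rw [Subsingleton.elim x 0]
      exact iff_of_true a.toSubmodule.zero_mem b.toSubmodule.zero_mem)
  rw [hTc, map_smul, LinearMap.trace_id, smul_eq_mul, mul_eq_zero, Nat.cast_eq_zero] at htr
  rw [hTc, htr.resolve_right Module.finrank_pos.ne', zero_smul]

end Completeness

namespace Representation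

variable {k G M : Type*} [Field k] [Group G] [AddCommGroup M] [Module k M] [Module k[G] M]
  [IsScalarTower k k[G] M]

variable (k G M) in
theorem asAlgebraHom_ofModule' :
    (ofModule' (k := k) (G := G) M).asAlgebraHom = Algebra.lsmul k k M :=
  (MonoidAlgebra.lift k (M →ₗ[k] M) G).apply_symm_apply _

variable (k G M) in
theorem isIrreducible_ofModule' [IsSimpleModule k[G] M] :
    (ofModule' (k := k) (G := G) M).IsIrreducible := by
  rw [irreducible_iff_isSimpleModule_asModule]
  let e : (ofModule' (k := k) (G := G) M).asModule ≃ₗ[k[G]] M :=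
    { (ofModule' (k := k) (G := G) M).asModuleEquiv.toAddEquiv with
      map_smul' r x := by
        refine (asModuleEquiv_map_smul _ r x).trans ?_
        rw [asAlgebraHom_ofModule']
        rfl }
  exact IsSimpleModule.congr e

end Representation

section ClassFunction

variable {k G : Type} [Field k] [IsAlgClosed k] [CharZero k] [Group G] [Fintype G]

theorem Representation.simple_of_isIrreducible {V : Type} [AddCommGroup V] [Module k V]
    [FiniteDimensional k V] (ρ : Representation k G V) [ρ.IsIrreducible] :
    CategoryTheory.Simple (FDRep.of ρ) := by
  have := invertibleOfNonzero (NeZero.ne (Nat.card G : k))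
  have h := ρ.char_orthonormal ρ
  rw [if_pos ⟨.refl ρ⟩, inv_mul_eq_one₀ (NeZero.ne _)] at h
  exact (FDRep.simple_iff_char_is_norm_one _).2 h.symm

/-- Completeness of the irreducible characters among class functions. -/
theorem FDRep.eq_zero_of_orthogonal_simple {f : G → k} (hf : ∀ g h, f (h * g * h⁻¹) = f g)
    (horth : ∀ V : FDRep k G, CategoryTheory.Simple V → ∑ g, f g * V.character g⁻¹ = 0) :
    f = 0 := by
  set z : k[G] := ∑ g, MonoidAlgebra.single g⁻¹ (f g) with hz
  have hann : z ∈ Module.annihilator k[G] k[G] := by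
    rw [← Submodule.annihilator_top, ← IsSemisimpleModule.sSup_simples_eq_top, sSup_eq_iSup',
      Submodule.annihilator_iSup, Submodule.mem_iInf]
    rintro ⟨S, hS⟩
    have : IsSimpleModule k[G] S := hS
    have := Representation.isIrreducible_ofModule' k G S
    have : FiniteDimensional k S := Module.Finite.trans k[G] S
    let σ := Representation.ofModule' (k := k) (G := G) S
    have hσ : ∑ g, f g * σ.character g⁻¹ = 0 :=
      horth (FDRep.of σ) (Representation.simple_of_isIrreducible σ)
    have hzero := Representation.sum_smul_eq_zero_of_orthogonal σ hf hσ
    have hzS : σ.asAlgebraHom z = 0 := by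
      rw [hz, map_sum, ← hzero]
      simp
    rw [Representation.asAlgebraHom_ofModule'] at hzS
    exact Module.mem_annihilator.2 fun x ↦ LinearMap.congr_fun hzS x
  have hz0 : z = 0 := by simpa using Module.mem_annihilator.1 hann 1
  ext g
  classical
  have := congrArg (fun y : k[G] ↦ y.coeff g⁻¹) hz0
  simpa [hz, Finsupp.single_apply] using this

variable (k G) in
/-- The set of irreducible characters. -/
def irreducibleCharacters : Set (G → k) :=
  {χ | ∃ V : FDRep k G, CategoryTheory.Simple V ∧ V.character = χ}

theorem irreducibleCharacters_orthonormal [DecidableEq (G → k)] {χ ψ : G → k}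
    (hχ : χ ∈ irreducibleCharacters k G)
    (hψ : ψ ∈ irreducibleCharacters k G) :
    ∑ g, χ g * ψ g⁻¹ = if χ = ψ then (Nat.card G : k) else 0 := by
  obtain ⟨V, hV, rfl⟩ := hχ
  obtain ⟨W, hW, rfl⟩ := hψ
  split_ifs with h
  · rw [← h]
    exact (FDRep.simple_iff_char_is_norm_one V).1 hV
  · have := invertibleOfNonzero (NeZero.ne (Nat.card G : k))
    have horth := FDRep.char_orthonormal V W
    rw [if_neg fun ⟨i⟩ ↦ h (FDRep.char_iso i)] at horth
    exact (mul_eq_zero.1 horth).resolve_left (inv_ne_zero (NeZero.ne _))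

variable (k G) in
theorem finite_irreducibleCharacters : (irreducibleCharacters k G).Finite := by
  classical
  suffices LinearIndependent k ((↑) : irreducibleCharacters k G → G → k) from
    this.setFinite
  rw [linearIndependent_iff']
  intro s c hc ψ hψ
  have h := congrArg (fun f : G → k ↦ ∑ g, f g * ψ.1 g⁻¹) hc
  simp only [Finset.sum_apply, Pi.smul_apply, smul_eq_mul, Finset.sum_mul, Pi.zero_apply,
    zero_mul, Finset.sum_const_zero, mul_assoc] at h
  rw [Finset.sum_comm] at h
  simp only [← Finset.mul_sum, irreducibleCharacters_orthonormal (Subtype.mem _) ψ.2,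
    Subtype.val_inj] at h
  simpa [hψ] using h

/-- Column orthogonality. -/
theorem sum_irreducibleCharacters_mul [DecidableEq G] {I : Finset (G → k)}
    (hI : ∀ χ, χ ∈ I ↔ χ ∈ irreducibleCharacters k G) (a b : G) :
    ∑ χ ∈ I, χ a⁻¹ * χ b = (Finset.univ.filter fun x ↦ x * a * x⁻¹ = b).card := by
  classical
  let N : G → k := fun b ↦ ∑ x : G, if x * a * x⁻¹ = b then 1 else 0
  have hconj (χ : G → k) (hχ : χ ∈ irreducibleCharacters k G) (g h : G) :
      χ (h * g * h⁻¹) = χ g := by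
    obtain ⟨V, -, rfl⟩ := hχ
    exact V.char_conj g h
  have hN (ψ : G → k) (hψ : ψ ∈ irreducibleCharacters k G) :
      ∑ g, N g * ψ g⁻¹ = Nat.card G * ψ a⁻¹ := by
    simp only [N, Finset.sum_mul, ite_mul, one_mul, zero_mul]
    rw [Finset.sum_comm]
    have (x : G) : ψ (x * a * x⁻¹)⁻¹ = ψ a⁻¹ := by
      rw [← hconj ψ hψ a⁻¹ x]
      group
    simp only [Finset.sum_ite_eq, Finset.mem_univ, if_true, this]
    simp
  have hzero : (fun b ↦ ∑ χ ∈ I, χ a⁻¹ * χ b - N b) = 0 := by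
    refine FDRep.eq_zero_of_orthogonal_simple (fun g h ↦ ?_) fun V hV ↦ ?_
    · congr 1
      · exact Finset.sum_congr rfl fun χ hχ ↦ by rw [hconj χ ((hI χ).1 hχ)]
      · refine Fintype.sum_equiv (Equiv.mulLeft h⁻¹) _ _ fun x ↦ if_congr ?_ rfl rfl
        rw [Equiv.coe_mulLeft, ← mul_right_inj h⁻¹, ← mul_left_inj h]
        simp [mul_assoc]
    · have hψ : V.character ∈ irreducibleCharacters k G := ⟨V, hV, rfl⟩
      simp only [sub_mul, Finset.sum_sub_distrib, hN _ hψ, Finset.sum_mul, mul_assoc]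
      rw [Finset.sum_comm]
      simp only [← Finset.mul_sum]
      rw [Finset.sum_congr rfl fun χ hχ ↦ by
        rw [irreducibleCharacters_orthonormal ((hI χ).1 hχ) hψ]]
      simp [(hI _).2 hψ, mul_comm]
  have := congrFun hzero b
  simpa [N, sub_eq_zero] using this

theorem comp_inv_mem_irreducibleCharacters {χ : G → k} (hχ : χ ∈ irreducibleCharacters k G) :
    (fun g ↦ χ g⁻¹) ∈ irreducibleCharacters k G := by
  obtain ⟨V, hV, rfl⟩ := hχ
  refine ⟨FDRep.of (Representation.dual V.ρ), ?_, funext fun g ↦ V.char_dual g⟩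
  rw [FDRep.simple_iff_char_is_norm_one] at hV ⊢
  simpa [mul_comm] using hV

/-- Self-dual irreducible characters are counted by the pairs `(a, x)` such that `x` inverts `a`. -/
theorem card_filter_comp_inv_mul_card [DecidableEq G] [DecidableEq (G → k)] {I : Finset (G → k)}
    (hI : ∀ χ, χ ∈ I ↔ χ ∈ irreducibleCharacters k G) :
    (I.filter fun χ ↦ χ = fun g ↦ χ g⁻¹).card * Fintype.card G =
      ∑ a : G, (Finset.univ.filter fun x ↦ x * a * x⁻¹ = a⁻¹).card := by
  rw [← Nat.cast_inj (R := k)]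
  push_cast
  simp only [← sum_irreducibleCharacters_mul hI]
  rw [Finset.sum_comm, Finset.card_filter, Nat.cast_sum, Finset.sum_mul]
  refine Finset.sum_congr rfl fun χ hχ ↦ ?_
  have hχ' := (hI χ).1 hχ
  have := irreducibleCharacters_orthonormal hχ' (comp_inv_mem_irreducibleCharacters hχ')
  simp only [inv_inv] at this
  have hsum : ∑ a : G, χ a⁻¹ * χ a⁻¹ = ∑ a, χ a * χ a :=
    Equiv.sum_comp (Equiv.inv G) fun a ↦ χ a * χ a
  rw [hsum, this]
  split_ifs <;> simp

end ClassFunction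

/-- The substitution `(g, h) ↦ (g * h, g)`. -/
theorem card_sq_mul_sq_eq_one (G : Type*) [Group G] [Fintype G] [DecidableEq G] :
    Nat.card {p : G × G // p.1 ^ 2 * p.2 ^ 2 = 1} =
      ∑ a : G, (Finset.univ.filter fun x ↦ x * a * x⁻¹ = a⁻¹).card := by
  let e : G × G ≃ (_ : G) × G :=
    { toFun p := ⟨p.1 * p.2, p.1⟩
      invFun p := (p.2, p.2⁻¹ * p.1)
      left_inv p := by simp
      right_inv p := by simp }
  rw [← Finset.card_sigma, Nat.card_eq_fintype_card, Fintype.card_subtype]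
  refine Finset.card_equiv e fun p ↦ ?_
  simp only [Finset.mem_filter, Finset.mem_univ, true_and, Finset.mem_sigma, e,
    Equiv.coe_fn_mk, eq_inv_iff_mul_eq_one]
  rw [show p.1 * (p.1 * p.2) * p.1⁻¹ * (p.1 * p.2) = p.1 ^ 2 * p.2 ^ 2 by simp [pow_two, mul_assoc]]

/-- The number of real-valued irreducible characters of `G` equals `s(2)/|G|`, where
`s(2) = |{(g,h) : g²h² = 1}|`. -/
theorem stmt_10 {G : Type} [Group G] [Fintype G] (IrrR : Finset (G → ℂ))
    (hIrrR : ∀ χ : G → ℂ, χ ∈ IrrR ↔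
      (∃ V : FDRep ℂ G, CategoryTheory.Simple V ∧ V.character = χ) ∧
        ∀ g : G, ∃ r : ℝ, χ g = (r : ℂ)) :
    IrrR.card * Fintype.card G = Nat.card {p : G × G // p.1 ^ 2 * p.2 ^ 2 = 1} := by
  classical
  have hI (χ : G → ℂ) : χ ∈ (finite_irreducibleCharacters ℂ G).toFinset ↔
      χ ∈ irreducibleCharacters ℂ G := Set.Finite.mem_toFinset _
  rw [card_sq_mul_sq_eq_one, ← card_filter_comp_inv_mul_card hI]
  congr 2
  ext χ
  rw [hIrrR, Finset.mem_filter, hI]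
  refine and_congr_right ?_
  rintro ⟨V, -, rfl⟩
  have hstar (g : G) : V.character g⁻¹ = conj (V.character g) :=
    Representation.character_inv_eq_star V.ρ g
  simp only [funext_iff, hstar]
  exact forall_congr' fun g ↦ Complex.conj_eq_iff_real.symm.trans eq_comm
end

section
/- Let G be a finite group with k = k_r(G) real-valued irreducible characters, and s(n) = |{(g₁,…,gₙ) ∈ Gⁿ : g₁²⋯gₙ² = 1}|. Then the multiset {χ(1)·ε(χ) : χ ∈ Irr_ℝ(G)} is uniquely determined by the values s(1), s(2), …, s(k+1). In particular, if two finite groups G and H have the same order, the same number of real irreducible characters k, and s_G(n) = s_H(n) for n = 1,…,k+1, then the multisets {χ(1)ε(χ) : χ ∈ Irr_ℝ(G)} and {χ(1)ε(χ) : χ ∈ Irr_ℝ(H)} coincide. -/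
open Matrix CategoryTheory

/-- A unitary matrix representation satisfying the conclusion of Schur's lemma. -/
structure IsUnitaryIrrep {G : Type*} [Group G] {d : ℕ} (R : G →* Matrix (Fin d) (Fin d) ℂ) :
    Prop where
  mul_conjTranspose (g : G) : R g * (R g)ᴴ = 1
  schur (X : Matrix (Fin d) (Fin d) ℂ) (hX : ∀ g, R g * X = X * R g) : ∃ c : ℂ, X = c • 1

theorem FDRep.exists_eq_smul_id_of_commute {G : Type} [Group G] [Finite G] (V : FDRep ℂ G)
    [Simple V] (f : V →ₗ[ℂ] V) (hf : ∀ g, V.ρ g ∘ₗ f = f ∘ₗ V.ρ g) :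
    ∃ c : ℂ, f = c • LinearMap.id := by
  have h1 : Module.finrank ℂ (Representation.linHom V.ρ V.ρ).invariants = 1 := by
    rw [(Representation.linHom.invariantsEquivFDRepHom V V).finrank_eq]
    exact finrank_endomorphism_simple_eq_one ℂ V
  have comm (f : V →ₗ[ℂ] V) (hf : ∀ g, V.ρ g ∘ₗ f = f ∘ₗ V.ρ g) :
      f ∈ (Representation.linHom V.ρ V.ρ).invariants := by
    intro g
    rw [Representation.linHom_apply, ← LinearMap.comp_assoc, hf, LinearMap.comp_assoc,
      ← Module.End.mul_eq_comp (V.ρ g), ← map_mul, mul_inv_cancel, map_one]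
    rfl
  have hid : (⟨LinearMap.id, comm _ fun _ => rfl⟩ :
      (Representation.linHom V.ρ V.ρ).invariants) ≠ 0 := by
    intro h
    have h2 : (LinearMap.id : V →ₗ[ℂ] V) = 0 := congrArg Subtype.val h
    have h0 (f : (Representation.linHom V.ρ V.ρ).invariants) : f = 0 := by
      ext x
      have := congrArg f.1 (LinearMap.congr_fun h2 x)
      simpa using this
    have : Subsingleton (Representation.linHom V.ρ V.ρ).invariants :=
      ⟨fun a b => by rw [h0 a, h0 b]⟩
    rw [Module.finrank_zero_of_subsingleton] at h1
    omega
  obtain ⟨c, hc⟩ := (finrank_eq_one_iff_of_nonzero' _ hid).mp h1 ⟨f, comm f hf⟩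
  exact ⟨c, (congrArg Subtype.val hc).symm⟩

open scoped ComplexOrder MatrixOrder in
theorem exists_unitarization {G : Type*} [Group G] [Fintype G] {d : ℕ}
    (R : G →* Matrix (Fin d) (Fin d) ℂ) :
    ∃ S : (Matrix (Fin d) (Fin d) ℂ)ˣ, ∀ g,
      (S * R g * S⁻¹ : Matrix (Fin d) (Fin d) ℂ) *
        (S * R g * S⁻¹ : Matrix (Fin d) (Fin d) ℂ)ᴴ = 1 := by
  set P : Matrix (Fin d) (Fin d) ℂ := ∑ g, (R g)ᴴ * R g with hP
  have hinv (h : G) : (R h)ᴴ * P * R h = P := by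
    rw [hP, Finset.mul_sum, Finset.sum_mul]
    refine Fintype.sum_equiv (Equiv.mulRight h) _ _ fun g => ?_
    simp [Matrix.conjTranspose_mul, Matrix.mul_assoc]
  have hpos : P.PosDef := by
    classical
    rw [hP, ← Finset.add_sum_erase _ _ (Finset.mem_univ (1 : G))]
    refine Matrix.PosDef.add_posSemidef (by simpa using Matrix.PosDef.one) ?_
    exact Matrix.posSemidef_sum _ fun g _ => Matrix.posSemidef_conjTranspose_mul_self _
  obtain ⟨S, hS, hPS⟩ : ∃ S : Matrix (Fin d) (Fin d) ℂ, IsUnit S ∧ P = Sᴴ * S := by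
    obtain ⟨S, hS⟩ := CStarAlgebra.nonneg_iff_eq_star_mul_self.mp hpos.posSemidef.nonneg
    refine ⟨S, ?_, hS⟩
    have h := hpos.isUnit
    rw [hS, Matrix.isUnit_iff_isUnit_det, Matrix.det_mul] at h
    exact (Matrix.isUnit_iff_isUnit_det S).mpr (isUnit_of_mul_isUnit_right h)
  obtain ⟨S, rfl⟩ := hS
  refine ⟨S, fun g => ?_⟩
  rw [mul_eq_one_comm]
  have h1 : (S : Matrix (Fin d) (Fin d) ℂ) * (S⁻¹ : (Matrix (Fin d) (Fin d) ℂ)ˣ) = 1 := S.mul_inv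
  have h2 := congrArg conjTranspose h1
  rw [conjTranspose_mul, conjTranspose_one] at h2
  have h3 := hinv g
  rw [hPS] at h3
  simp only [conjTranspose_mul]
  calc _ = (↑S⁻¹ : Matrix (Fin d) (Fin d) ℂ)ᴴ *
        ((R g)ᴴ * ((S : Matrix (Fin d) (Fin d) ℂ)ᴴ * S) * R g) *
        (↑S⁻¹ : Matrix (Fin d) (Fin d) ℂ) := by simp only [Matrix.mul_assoc]
    _ = ((↑S⁻¹ : Matrix (Fin d) (Fin d) ℂ)ᴴ * (S : Matrix (Fin d) (Fin d) ℂ)ᴴ) *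
        (S * (↑S⁻¹ : Matrix (Fin d) (Fin d) ℂ)) := by rw [h3]; simp only [Matrix.mul_assoc]
    _ = 1 := by rw [h1, h2, one_mul]

theorem FDRep.exists_isUnitaryIrrep {G : Type} [Group G] [Fintype G] (V : FDRep ℂ G) [Simple V] :
    ∃ (d : ℕ) (R : G →* Matrix (Fin d) (Fin d) ℂ), IsUnitaryIrrep R ∧
      ∀ g, V.character g = (R g).trace := by
  let b := Module.finBasis ℂ V
  let R₀ : G →* Matrix (Fin (Module.finrank ℂ V)) (Fin (Module.finrank ℂ V)) ℂ :=
    (LinearMap.toMatrixAlgEquiv b : _ →* _).comp V.ρ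
  obtain ⟨S, hS⟩ := exists_unitarization R₀
  have h1 : S.1 * S⁻¹.1 = 1 := S.mul_inv
  have h2 : S⁻¹.1 * S.1 = 1 := S.inv_mul
  let R : G →* Matrix (Fin (Module.finrank ℂ V)) (Fin (Module.finrank ℂ V)) ℂ :=
    { toFun g := S.1 * R₀ g * S⁻¹.1
      map_one' := by simp
      map_mul' g h := by
        rw [map_mul, show S.1 * R₀ g * S⁻¹.1 * (S.1 * R₀ h * S⁻¹.1) =
          S.1 * R₀ g * (S⁻¹.1 * S.1) * R₀ h * S⁻¹.1 by simp only [Matrix.mul_assoc], h2]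
        simp only [Matrix.mul_assoc, Matrix.one_mul] }
  refine ⟨_, R, ⟨hS, fun X hX => ?_⟩, fun g => ?_⟩
  · obtain ⟨c, hc⟩ := V.exists_eq_smul_id_of_commute
      (Matrix.toLin b b (S⁻¹.1 * X * S.1)) fun g => by
        apply (LinearMap.toMatrixAlgEquiv b).injective
        rw [← Module.End.mul_eq_comp, ← Module.End.mul_eq_comp,
          map_mul (LinearMap.toMatrixAlgEquiv b), map_mul (LinearMap.toMatrixAlgEquiv b)]
        have h3 : R₀ g = S⁻¹.1 * R g * S.1 := by
          change _ = S⁻¹.1 * (S.1 * R₀ g * S⁻¹.1) * S.1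
          simp only [Matrix.mul_assoc, h2, Matrix.mul_one]
          rw [← Matrix.mul_assoc, h2, Matrix.one_mul]
        have h4 : LinearMap.toMatrixAlgEquiv b (Matrix.toLin b b (S⁻¹.1 * X * S.1)) =
          S⁻¹.1 * X * S.1 := LinearMap.toMatrix_toLin b b _
        rw [h4]
        change R₀ g * _ = _ * R₀ g
        calc R₀ g * (S⁻¹.1 * X * S.1) = S⁻¹.1 * R g * (S.1 * S⁻¹.1) * X * S.1 := by
              rw [h3]; simp only [Matrix.mul_assoc]
          _ = S⁻¹.1 * X * (S.1 * S⁻¹.1) * R g * S.1 := by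
              rw [h1, Matrix.mul_one, Matrix.mul_one, Matrix.mul_assoc _ (R g), hX,
                ← Matrix.mul_assoc]
          _ = S⁻¹.1 * X * S.1 * R₀ g := by
              rw [h3]; simp only [Matrix.mul_assoc]
    refine ⟨c, ?_⟩
    have h3 := congrArg (LinearMap.toMatrix b b) hc
    rw [LinearMap.toMatrix_toLin, map_smul, LinearMap.toMatrix_id] at h3
    calc X = (S.1 * S⁻¹.1) * X * (S.1 * S⁻¹.1) := by rw [h1]; simp
      _ = S.1 * (S⁻¹.1 * X * S.1) * S⁻¹.1 := by simp only [Matrix.mul_assoc]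
      _ = c • 1 := by rw [h3]; simp
  · change LinearMap.trace ℂ V (V.ρ g) = (S.1 * R₀ g * S⁻¹.1).trace
    rw [Matrix.trace_mul_comm, ← Matrix.mul_assoc, h2, Matrix.one_mul,
      LinearMap.trace_eq_matrix_trace ℂ b]
    rfl

theorem Representation.asAlgebraHom_ofModule'_s15 {k G M : Type*} [CommRing k] [Monoid G]
    [AddCommGroup M] [Module k M] [Module (MonoidAlgebra k G) M]
    [IsScalarTower k (MonoidAlgebra k G) M] (a : MonoidAlgebra k G) (x : M) :
    (Representation.ofModule' (k := k) (G := G) M).asAlgebraHom a x = a • x := by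
  exact congrArg (fun f : MonoidAlgebra k G →ₐ[k] Module.End k M => f a x)
    ((MonoidAlgebra.lift k (Module.End k M) G).apply_symm_apply (Algebra.lsmul k k M))

theorem Representation.IsIrreducible.simple_of {G : Type} [Group G] [Fintype G] {V : Type}
    [AddCommGroup V] [Module ℂ V] [FiniteDimensional ℂ V] (ρ : Representation ℂ G V)
    [ρ.IsIrreducible] : Simple (FDRep.of ρ) := by
  rw [FDRep.simple_iff_char_is_norm_one]
  have : Invertible (Nat.card G : ℂ) := invertibleOfNonzero (by simp)
  have h := Representation.char_orthonormal ρ ρ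
  rw [if_pos ⟨Representation.Equiv.refl ρ⟩, inv_mul_eq_one₀ (by simp)] at h
  exact h.symm

theorem Representation.isIrreducible_ofModule'_s15 {k G M : Type*} [Field k] [Monoid G]
    [AddCommGroup M] [Module k M] [Module (MonoidAlgebra k G) M]
    [IsScalarTower k (MonoidAlgebra k G) M] [IsSimpleModule (MonoidAlgebra k G) M] :
    (Representation.ofModule' (k := k) (G := G) M).IsIrreducible := by
  let e : (Representation.ofModule' (k := k) (G := G) M).asModule ≃ₗ[MonoidAlgebra k G] M :=
    { (Representation.ofModule' (k := k) (G := G) M).asModuleEquiv with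
      map_smul' r x := (Representation.asModuleEquiv_map_smul _ r x).trans
        (Representation.asAlgebraHom_ofModule'_s15 r _) }
  exact (Representation.irreducible_iff_isSimpleModule_asModule _).mpr (IsSimpleModule.congr e)

theorem MonoidAlgebra.smul_eq_zero_of_forall_simple {G : Type} [Group G] [Fintype G]
    (a : MonoidAlgebra ℂ G)
    (ha : ∀ V : FDRep ℂ G, Simple V → Representation.asAlgebraHom V.ρ a = 0)
    {M : Type} [AddCommGroup M] [Module ℂ M] [Module (MonoidAlgebra ℂ G) M]
    [IsScalarTower ℂ (MonoidAlgebra ℂ G) M]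
    [IsSimpleModule (MonoidAlgebra ℂ G) M] (x : M) : a • x = 0 := by
  have : Module.Finite ℂ M := Module.Finite.trans (MonoidAlgebra ℂ G) M
  have hirr := Representation.isIrreducible_ofModule'_s15 (k := ℂ) (G := G) (M := M)
  have h := ha _ (hirr.simple_of _)
  rw [FDRep.of_ρ'] at h
  exact (Representation.asAlgebraHom_ofModule'_s15 (k := ℂ) a x).symm.trans (LinearMap.congr_fun h x)

theorem MonoidAlgebra.eq_zero_of_forall_simple {G : Type} [Group G] [Fintype G]
    (a : MonoidAlgebra ℂ G)
    (ha : ∀ V : FDRep ℂ G, Simple V → Representation.asAlgebraHom V.ρ a = 0) : a = 0 := by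
  have hbot : Ring.jacobson (MonoidAlgebra ℂ G) = ⊥ := IsSemisimpleRing.jacobson_eq_bot _
  rw [← Submodule.mem_bot (MonoidAlgebra ℂ G), ← hbot, Ring.jacobson, Module.jacobson,
    Submodule.mem_sInf]
  intro m hm
  have hsimple : IsSimpleModule (MonoidAlgebra ℂ G) (MonoidAlgebra ℂ G ⧸ m) :=
    isSimpleModule_iff_isCoatom.mpr hm
  have h := a.smul_eq_zero_of_forall_simple ha (M := MonoidAlgebra ℂ G ⧸ m)
    (Submodule.Quotient.mk 1)
  rwa [← Submodule.Quotient.mk_smul, Submodule.Quotient.mk_eq_zero, smul_eq_mul, mul_one] at h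

namespace IsUnitaryIrrep

variable {G : Type*} [Group G] {d : ℕ} {R : G →* Matrix (Fin d) (Fin d) ℂ}

theorem map_inv (hR : IsUnitaryIrrep R) (g : G) : R g⁻¹ = (R g)ᴴ := by
  have h1 : R g⁻¹ * R g = 1 := by rw [← map_mul, inv_mul_cancel, map_one]
  calc R g⁻¹ = R g⁻¹ * (R g * (R g)ᴴ) := by rw [hR.mul_conjTranspose, Matrix.mul_one]
    _ = (R g)ᴴ := by rw [← Matrix.mul_assoc, h1, Matrix.one_mul]

theorem trace_inv (hR : IsUnitaryIrrep R) (g : G) : (R g⁻¹).trace = star (R g).trace := by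
  rw [hR.map_inv, Matrix.trace_conjTranspose]

theorem transpose_mul (hR : IsUnitaryIrrep R) (g : G) : (R g)ᵀ * ((R g)ᵀ)ᴴ = 1 := by
  have h := congrArg transpose (mul_eq_one_comm.mp (hR.mul_conjTranspose g))
  rwa [Matrix.transpose_mul, Matrix.transpose_one] at h

theorem mul_conjTranspose_eq_smul_one (hR : IsUnitaryIrrep R) {X Y : Matrix (Fin d) (Fin d) ℂ}
    (hX : ∀ g, R g * X * (R g)ᵀ = X) (hY : ∀ g, R g * Y * (R g)ᵀ = Y) :
    ∃ c : ℂ, Y * Xᴴ = c • 1 := by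
  refine hR.schur _ fun g => ?_
  have h : Y * Xᴴ = R g * (Y * Xᴴ) * (R g)ᴴ := by
    conv_lhs => rw [← hX g, ← hY g]
    simp only [Matrix.conjTranspose_mul]
    calc _ = R g * Y * ((R g)ᵀ * ((R g)ᵀ)ᴴ) * Xᴴ * (R g)ᴴ := by simp only [Matrix.mul_assoc]
      _ = _ := by rw [hR.transpose_mul]; simp only [Matrix.mul_assoc, Matrix.one_mul]
  conv_rhs => rw [h]
  rw [Matrix.mul_assoc _ (R g)ᴴ, mul_eq_one_comm.mp (hR.mul_conjTranspose g), Matrix.mul_one]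

theorem exists_mul_conjTranspose_self (hR : IsUnitaryIrrep R) {X : Matrix (Fin d) (Fin d) ℂ}
    (hX : ∀ g, R g * X * (R g)ᵀ = X) (h0 : X ≠ 0) :
    ∃ b : ℂ, b ≠ 0 ∧ X * Xᴴ = b • 1 ∧ Xᴴ * X = b • 1 := by
  obtain ⟨b, hb⟩ := hR.mul_conjTranspose_eq_smul_one hX hX
  have hb0 : b ≠ 0 := by
    rintro rfl
    rw [zero_smul] at hb
    open scoped ComplexOrder in exact h0 (Matrix.self_mul_conjTranspose_eq_zero.mp hb)
  refine ⟨b, hb0, hb, ?_⟩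
  have h1 : X * (b⁻¹ • Xᴴ) = 1 := by
    rw [Matrix.mul_smul, hb, smul_smul, inv_mul_cancel₀ hb0, one_smul]
  rw [mul_eq_one_comm, Matrix.smul_mul] at h1
  rw [← h1, smul_smul, mul_inv_cancel₀ hb0, one_smul]

theorem exists_eq_smul_of_invariant (hR : IsUnitaryIrrep R) {X Y : Matrix (Fin d) (Fin d) ℂ}
    (hX : ∀ g, R g * X * (R g)ᵀ = X) (h0 : X ≠ 0) (hY : ∀ g, R g * Y * (R g)ᵀ = Y) :
    ∃ c : ℂ, Y = c • X := by
  obtain ⟨b, hb0, -, hb⟩ := hR.exists_mul_conjTranspose_self hX h0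
  obtain ⟨a, ha⟩ := hR.mul_conjTranspose_eq_smul_one hX hY
  refine ⟨b⁻¹ * a, ?_⟩
  have h : b • Y = a • X := by
    calc b • Y = Y * (Xᴴ * X) := by rw [hb]; simp
      _ = a • X := by rw [← Matrix.mul_assoc, ha]; simp
  rw [mul_smul, ← h, smul_smul, inv_mul_cancel₀ hb0, one_smul]

theorem star_trace_of_invariant (hR : IsUnitaryIrrep R) {X : Matrix (Fin d) (Fin d) ℂ}
    (hX : ∀ g, R g * X * (R g)ᵀ = X) (h0 : X ≠ 0) (g : G) :
    star (R g).trace = (R g).trace := by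
  obtain ⟨b, hb0, hb, hb'⟩ := hR.exists_mul_conjTranspose_self hX h0
  have h1 : R g * X = X * ((R g)ᵀ)ᴴ := by
    conv_rhs => rw [← hX g]
    rw [Matrix.mul_assoc (R g * X), hR.transpose_mul, Matrix.mul_one]
  have h2 : (R g * (X * Xᴴ)).trace = (((R g)ᵀ)ᴴ * (Xᴴ * X)).trace := by
    rw [← Matrix.mul_assoc, h1, Matrix.mul_assoc, Matrix.trace_mul_comm, Matrix.mul_assoc]
  rw [hb, hb'] at h2
  simp only [Matrix.mul_smul, Matrix.mul_one, Matrix.trace_smul, smul_eq_mul,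
    Matrix.trace_conjTranspose, Matrix.trace_transpose] at h2
  exact (mul_left_cancel₀ hb0 h2).symm

theorem exists_transpose_eq_smul (hR : IsUnitaryIrrep R) :
    ∃ c : ℂ, c ^ 2 = 1 ∧ ∀ X : Matrix (Fin d) (Fin d) ℂ,
      (∀ g, R g * X * (R g)ᵀ = X) → Xᵀ = c • X := by
  by_cases h : ∃ X : Matrix (Fin d) (Fin d) ℂ, (∀ g, R g * X * (R g)ᵀ = X) ∧ X ≠ 0
  · obtain ⟨X, hX, h0⟩ := h
    have hXt (g : G) : R g * Xᵀ * (R g)ᵀ = Xᵀ := by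
      conv_rhs => rw [← hX g]
      simp [Matrix.transpose_mul, Matrix.mul_assoc]
    obtain ⟨c, hc⟩ := hR.exists_eq_smul_of_invariant hX h0 hXt
    refine ⟨c, ?_, fun Y hY => ?_⟩
    · have h1 := congrArg transpose hc
      rw [Matrix.transpose_transpose, Matrix.transpose_smul, hc, smul_smul] at h1
      have h2 : (c ^ 2 - 1) • X = 0 := by rw [sub_smul, one_smul, pow_two, ← h1, sub_self]
      exact sub_eq_zero.mp ((smul_eq_zero.mp h2).resolve_right h0)
    · obtain ⟨a, rfl⟩ := hR.exists_eq_smul_of_invariant hX h0 hY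
      rw [Matrix.transpose_smul, hc, smul_comm]
  · push Not at h
    refine ⟨1, by simp, fun X hX => ?_⟩
    rw [h X hX]; simp

variable [Fintype G]

variable (R) in
/-- The average of `X` under the action `X ↦ R g * X * (R g)ᵀ`, without normalization. -/
def twistedSum (X : Matrix (Fin d) (Fin d) ℂ) : Matrix (Fin d) (Fin d) ℂ :=
  ∑ g, R g * X * (R g)ᵀ

theorem twistedSum_invariant (X : Matrix (Fin d) (Fin d) ℂ) (h : G) :
    R h * twistedSum R X * (R h)ᵀ = twistedSum R X := by
  rw [twistedSum, Finset.mul_sum, Finset.sum_mul]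
  refine Fintype.sum_equiv (Equiv.mulLeft h) _ _ fun g => ?_
  simp [Matrix.mul_assoc, Matrix.transpose_mul]

theorem twistedSum_single_apply (i j a b : Fin d) :
    twistedSum R (Matrix.single j i 1) a b = ∑ g, R g a j * R g b i := by
  rw [twistedSum, Matrix.sum_apply]
  refine Finset.sum_congr rfl fun g _ => ?_
  simp [Matrix.mul_apply, Matrix.single_apply, ite_and]

theorem sum_trace_sq_eq :
    ∑ g, (R (g ^ 2)).trace = ∑ i, ∑ j, twistedSum R (Matrix.single j i 1) i j := by
  simp only [twistedSum_single_apply, pow_two, map_mul, Matrix.trace,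
    Matrix.diag_apply, Matrix.mul_apply]
  rw [Finset.sum_comm]
  exact Finset.sum_congr rfl fun i _ => Finset.sum_comm

theorem exists_sum_trace_sq_eq (hR : IsUnitaryIrrep R) :
    ∃ c : ℂ, c ^ 2 = 1 ∧ ∑ g, (R (g ^ 2)).trace = c * ∑ g, (R g).trace ^ 2 := by
  obtain ⟨c, hc, h⟩ := hR.exists_transpose_eq_smul
  refine ⟨c, hc, ?_⟩
  have h1 (i j : Fin d) : twistedSum R (Matrix.single j i 1) i j =
      c * ∑ g, R g j j * R g i i := by
    rw [← twistedSum_single_apply i j j i]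
    exact congrFun₂ (h _ (twistedSum_invariant _)) j i
  rw [sum_trace_sq_eq]
  simp only [h1, ← Finset.mul_sum]
  congr 1
  simp only [pow_two, Matrix.trace, Matrix.diag_apply, Finset.sum_mul_sum]
  symm
  rw [Finset.sum_comm]
  refine Finset.sum_congr rfl fun i _ => ?_
  rw [Finset.sum_comm]
  simp only [mul_comm]

theorem sum_trace_sq_eq_zero (hR : IsUnitaryIrrep R) {g : G}
    (hg : star (R g).trace ≠ (R g).trace) : ∑ g, (R (g ^ 2)).trace = 0 := by
  have h (X : Matrix (Fin d) (Fin d) ℂ) : twistedSum R X = 0 := by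
    by_contra h0
    exact hg (hR.star_trace_of_invariant (twistedSum_invariant X) h0 g)
  rw [sum_trace_sq_eq]
  simp [h]

theorem sum_prod_sq_eq_pow (n : ℕ) :
    ∑ v : Fin n → G, R ((List.ofFn v).map fun g => g ^ 2).prod = (∑ g, R (g ^ 2)) ^ n := by
  induction n with
  | zero => simp
  | succ n ih =>
    rw [pow_succ', ← ih, ← (Fin.consEquiv fun _ => G).sum_comp, Fintype.sum_prod_type,
      Finset.sum_mul_sum]
    simp [Fin.consEquiv, List.ofFn_succ]

theorem trace_sum_prod_sq (hR : IsUnitaryIrrep R) (hd : d ≠ 0) (n : ℕ) :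
    ∑ v : Fin n → G, (R ((List.ofFn v).map fun g => g ^ 2).prod).trace =
      d * ((∑ g, (R (g ^ 2)).trace) / d) ^ n := by
  obtain ⟨t, ht⟩ := hR.schur (∑ g, R (g ^ 2)) fun h => by
    rw [Finset.mul_sum, Finset.sum_mul]
    refine Fintype.sum_equiv (MulAut.conj h).toEquiv _ _ fun g => ?_
    rw [← map_mul, ← map_mul]
    simp [pow_two, mul_assoc]
  have hd' : (d : ℂ) ≠ 0 := Nat.cast_ne_zero.mpr hd
  have h1 : ∑ g, (R (g ^ 2)).trace = t * d := by
    rw [← Matrix.trace_sum, ht]; simp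
  rw [← Matrix.trace_sum, sum_prod_sq_eq_pow, ht, h1, mul_div_cancel_right₀ _ hd', smul_pow]
  simp [mul_comm]

end IsUnitaryIrrep

/-- `χ` is the character of an irreducible complex representation. -/
def IsIrrChar {G : Type} [Group G] (χ : G → ℂ) : Prop :=
  ∃ V : FDRep ℂ G, Simple V ∧ V.character = χ

namespace IsIrrChar

variable {G : Type} [Group G] {χ ψ : G → ℂ}

theorem apply_mul_comm (hχ : IsIrrChar χ) (g h : G) : χ (g * h) = χ (h * g) := by
  obtain ⟨V, hV, rfl⟩ := hχ
  exact V.char_mul_comm h g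

variable [Fintype G]

theorem exists_isUnitaryIrrep (hχ : IsIrrChar χ) :
    ∃ (d : ℕ) (R : G →* Matrix (Fin d) (Fin d) ℂ), IsUnitaryIrrep R ∧
      ∀ g, χ g = (R g).trace := by
  obtain ⟨V, hV, rfl⟩ := hχ
  exact V.exists_isUnitaryIrrep

theorem sum_mul_inv_self (hχ : IsIrrChar χ) : ∑ g, χ g * χ g⁻¹ = Fintype.card G := by
  obtain ⟨V, hV, rfl⟩ := hχ
  rw [(FDRep.simple_iff_char_is_norm_one V).mp hV, Nat.card_eq_fintype_card]

theorem sum_mul_inv_of_ne (hχ : IsIrrChar χ) (hψ : IsIrrChar ψ) (hne : χ ≠ ψ) :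
    ∑ g, χ g * ψ g⁻¹ = 0 := by
  obtain ⟨V, hV, rfl⟩ := hχ
  obtain ⟨W, hW, rfl⟩ := hψ
  have : Invertible (Nat.card G : ℂ) := invertibleOfNonzero (by simp)
  have h := FDRep.char_orthonormal V W
  rw [if_neg fun ⟨i⟩ => hne (FDRep.char_iso i)] at h
  exact (mul_eq_zero.mp h).resolve_left (by simp)

theorem apply_one_ne_zero (hχ : IsIrrChar χ) : χ 1 ≠ 0 := by
  obtain ⟨d, R, hR, hχR⟩ := hχ.exists_isUnitaryIrrep
  intro h
  rw [hχR, map_one, Matrix.trace_one, Fintype.card_fin, Nat.cast_eq_zero] at h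
  subst h
  have h1 := hχ.sum_mul_inv_self
  simp only [hχR, Matrix.trace, Finset.univ_eq_empty, Finset.sum_empty, mul_zero,
    Finset.sum_const_zero] at h1
  exact Fintype.card_ne_zero (Nat.cast_eq_zero.mp h1.symm)

theorem exists_sum_sq_eq (hχ : IsIrrChar χ) (hreal : ∀ g, ∃ r : ℝ, χ g = r) :
    ∃ c : ℂ, c ^ 2 = 1 ∧ ∑ g, χ (g ^ 2) = c * Fintype.card G := by
  have h0 := hχ.sum_mul_inv_self
  obtain ⟨d, R, hR, hχR⟩ := hχ.exists_isUnitaryIrrep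
  obtain ⟨c, hc, h⟩ := hR.exists_sum_trace_sq_eq
  refine ⟨c, hc, ?_⟩
  rw [← h0]
  simp only [hχR] at hreal ⊢
  rw [h]
  congr 1
  refine Finset.sum_congr rfl fun g _ => ?_
  obtain ⟨r, hr⟩ := hreal g
  rw [hR.trace_inv, hr, pow_two]
  simp

theorem sum_sq_eq_zero (hχ : IsIrrChar χ) (hreal : ¬ ∀ g, ∃ r : ℝ, χ g = r) :
    ∑ g, χ (g ^ 2) = 0 := by
  obtain ⟨d, R, hR, hχR⟩ := hχ.exists_isUnitaryIrrep
  push Not at hreal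
  obtain ⟨g, hg⟩ := hreal
  simp only [hχR] at hg ⊢
  refine hR.sum_trace_sq_eq_zero (g := g) fun h => ?_
  obtain ⟨r, hr⟩ := Complex.conj_eq_iff_real.mp h
  exact hg r hr

theorem sum_prod_sq (hχ : IsIrrChar χ) (n : ℕ) :
    ∑ v : Fin n → G, χ ((List.ofFn v).map fun g => g ^ 2).prod =
      χ 1 * ((∑ g, χ (g ^ 2)) / χ 1) ^ n := by
  have h0 := hχ.apply_one_ne_zero
  obtain ⟨d, R, hR, hχR⟩ := hχ.exists_isUnitaryIrrep
  simp only [hχR, map_one, Matrix.trace_one, Fintype.card_fin] at h0 ⊢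
  exact hR.trace_sum_prod_sq (by exact_mod_cast h0) n

variable (G) in
theorem finite_setOf : {χ : G → ℂ | IsIrrChar χ}.Finite := by
  have h : LinearIndependent ℂ (fun χ : {χ : G → ℂ | IsIrrChar χ} => (χ : G → ℂ)) := by
    rw [linearIndependent_iff']
    intro s a ha ψ hψ
    have h1 : ∑ g, (∑ χ ∈ s, a χ • (χ : G → ℂ)) g * ψ.1 g⁻¹ = a ψ * Fintype.card G := by
      simp only [Finset.sum_apply, Pi.smul_apply, smul_eq_mul, Finset.sum_mul, mul_assoc]
      rw [Finset.sum_comm]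
      simp only [← Finset.mul_sum]
      rw [Finset.sum_eq_single_of_mem ψ hψ fun χ _ hne => by
        rw [sum_mul_inv_of_ne χ.2 ψ.2 (Subtype.coe_injective.ne hne), mul_zero],
        sum_mul_inv_self ψ.2]
    rw [ha] at h1
    simpa using h1.symm
  exact h.setFinite

/-- A class function orthogonal to every irreducible character vanishes. -/
theorem eq_zero_of_forall_orthogonal (f : G → ℂ) (hf : ∀ g h, f (g * h) = f (h * g))
    (horth : ∀ ψ : G → ℂ, IsIrrChar ψ → ∑ g, f g * ψ g⁻¹ = 0) : f = 0 := by
  let a : MonoidAlgebra ℂ G := ∑ g, MonoidAlgebra.single g⁻¹ (f g)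
  have ha : a = 0 := by
    refine a.eq_zero_of_forall_simple fun V hV => ?_
    have h1 : Representation.asAlgebraHom V.ρ a = ∑ g, f g • V.ρ g⁻¹ := by
      simp [a, map_sum, Representation.asAlgebraHom_single]
    rw [h1]
    obtain ⟨c, hc⟩ := V.exists_eq_smul_id_of_commute (∑ g, f g • V.ρ g⁻¹) fun h => by
      rw [← Module.End.mul_eq_comp, ← Module.End.mul_eq_comp, Finset.mul_sum, Finset.sum_mul]
      refine Fintype.sum_equiv (MulAut.conj h).toEquiv _ _ fun g => ?_
      rw [mul_smul_comm, smul_mul_assoc, ← map_mul, ← map_mul]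
      simp [hf (h * g), ← mul_assoc]
    have h2 := horth V.character ⟨V, hV, rfl⟩
    have h3 : c * V.character 1 = 0 := by
      rw [← h2, FDRep.char_one]
      have h4 := congrArg (LinearMap.trace ℂ V) hc
      rw [map_smul, LinearMap.trace_id, map_sum] at h4
      simpa [FDRep.character] using h4.symm
    rw [hc, (mul_eq_zero.mp h3).resolve_right (apply_one_ne_zero ⟨V, hV, rfl⟩), zero_smul]
  ext g
  have h := congrArg (fun b : MonoidAlgebra ℂ G => b.coeff g⁻¹) ha
  classical simpa [a, Finsupp.single_apply, Finsupp.finsetSum_apply] using h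

theorem sum_apply_one_mul (Irr : Finset (G → ℂ)) (hIrr : ∀ χ, χ ∈ Irr ↔ IsIrrChar χ) (g : G)
    [Decidable (g = 1)] :
    ∑ χ ∈ Irr, χ 1 * χ g = if g = 1 then (Fintype.card G : ℂ) else 0 := by
  classical
  have h := eq_zero_of_forall_orthogonal
    (fun g => (∑ χ ∈ Irr, χ 1 * χ g) - if g = 1 then (Fintype.card G : ℂ) else 0)
    (fun g h => by
      congr 1
      · exact Finset.sum_congr rfl fun χ hχ => by rw [((hIrr χ).mp hχ).apply_mul_comm]
      · simp only [(mul_eq_one_comm : g * h = 1 ↔ h * g = 1)])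
    fun ψ hψ => by
      simp only [sub_mul, Finset.sum_sub_distrib, Finset.sum_mul, mul_assoc]
      rw [Finset.sum_comm]
      simp only [← Finset.mul_sum]
      rw [Finset.sum_eq_single_of_mem ψ ((hIrr ψ).mpr hψ) fun χ hχ hne => by
        rw [sum_mul_inv_of_ne ((hIrr χ).mp hχ) hψ hne, mul_zero], hψ.sum_mul_inv_self]
      simp [mul_comm]
  convert sub_eq_zero.mp (congrFun h g)

theorem card_mul_card_prod_sq (Irr : Finset (G → ℂ)) (hIrr : ∀ χ, χ ∈ Irr ↔ IsIrrChar χ)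
    (n : ℕ) :
    (Fintype.card G : ℂ) *
        Nat.card {v : Fin n → G // ((List.ofFn v).map fun g => g ^ 2).prod = 1} =
      ∑ χ ∈ Irr, χ 1 ^ 2 * ((∑ g, χ (g ^ 2)) / χ 1) ^ n := by
  classical
  have h : ∑ v : Fin n → G, ∑ χ ∈ Irr, χ 1 * χ ((List.ofFn v).map fun g => g ^ 2).prod =
      ∑ χ ∈ Irr, χ 1 ^ 2 * ((∑ g, χ (g ^ 2)) / χ 1) ^ n := by
    rw [Finset.sum_comm]
    refine Finset.sum_congr rfl fun χ hχ => ?_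
    rw [← Finset.mul_sum, ((hIrr χ).mp hχ).sum_prod_sq, pow_two, mul_assoc]
  rw [← h]
  simp only [sum_apply_one_mul Irr hIrr]
  rw [Finset.sum_ite, Finset.sum_const_zero, add_zero, Finset.sum_const, nsmul_eq_mul, mul_comm,
    Nat.card_eq_fintype_card, Fintype.card_subtype]

/-- The degree of `χ` times its Frobenius–Schur indicator. -/
noncomputable def signedDegree (χ : G → ℂ) : ℂ :=
  χ 1 * ((Fintype.card G : ℂ)⁻¹ * ∑ g : G, χ (g ^ 2))

theorem signedDegree_ne_zero (hχ : IsIrrChar χ) (hreal : ∀ g, ∃ r : ℝ, χ g = r) :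
    signedDegree χ ≠ 0 := by
  obtain ⟨c, hc, h⟩ := hχ.exists_sum_sq_eq hreal
  have hc0 : c ≠ 0 := by rintro rfl; simp at hc
  rw [signedDegree, h]
  simp [hχ.apply_one_ne_zero, hc0]

theorem sq_mul_div_pow (hχ : IsIrrChar χ) (hreal : ∀ g, ∃ r : ℝ, χ g = r) (n : ℕ) :
    χ 1 ^ 2 * ((∑ g, χ (g ^ 2)) / χ 1) ^ n =
      (Fintype.card G : ℂ) ^ n * (signedDegree χ ^ 2 * (signedDegree χ)⁻¹ ^ n) := by
  obtain ⟨c, hc, h⟩ := hχ.exists_sum_sq_eq hreal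
  have hc0 : c⁻¹ = c := inv_eq_of_mul_eq_one_left (by rw [← pow_two, hc])
  have h1 : signedDegree χ = χ 1 * c := by
    rw [signedDegree, h]; field_simp
  rw [h1, h, mul_inv, hc0, mul_pow (χ 1), hc, mul_one, div_eq_mul_inv, mul_left_comm, ← mul_pow]
  congr 2
  ring

theorem card_mul_card_prod_sq_of_pos (IrrR : Finset (G → ℂ))
    (hIrrR : ∀ χ : G → ℂ, χ ∈ IrrR ↔ IsIrrChar χ ∧ ∀ g, ∃ r : ℝ, χ g = r) {n : ℕ} (hn : n ≠ 0) :
    (Fintype.card G : ℂ) *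
        Nat.card {v : Fin n → G // ((List.ofFn v).map fun g => g ^ 2).prod = 1} =
      (Fintype.card G : ℂ) ^ n *
        ∑ χ ∈ IrrR, signedDegree χ ^ 2 * (signedDegree χ)⁻¹ ^ n := by
  have hmem (χ : G → ℂ) : χ ∈ (finite_setOf G).toFinset ↔ IsIrrChar χ := by simp
  rw [card_mul_card_prod_sq _ hmem, Finset.mul_sum]
  symm
  rw [← Finset.sum_subset (fun χ hχ => (hmem χ).mpr ((hIrrR χ).mp hχ).1) fun χ hχ hχ' => ?_]
  · refine Finset.sum_congr rfl fun χ hχ => ?_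
    obtain ⟨h1, h2⟩ := (hIrrR χ).mp hχ
    exact (h1.sq_mul_div_pow h2 n).symm
  · have h1 := (hmem χ).mp hχ
    rw [h1.sum_sq_eq_zero fun h2 => hχ' ((hIrrR χ).mpr ⟨h1, h2⟩)]
    simp [hn]

end IsIrrChar

section PowerSums

open Polynomial

variable {F σ τ : Type*} [Field F] [Fintype σ] [Fintype τ]

theorem aeval_esymm_eq_of_sum_pow_eq [CharZero F] {f : σ → F} {g : τ → F} {k : ℕ}
    (h : ∀ j < k, ∑ i, f i ^ j = ∑ i, g i ^ j) {n : ℕ} (hn : n < k) :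
    MvPolynomial.aeval f (MvPolynomial.esymm σ F n) =
      MvPolynomial.aeval g (MvPolynomial.esymm τ F n) := by
  induction n using Nat.strong_induction_on with
  | _ n ih =>
    rcases Nat.eq_zero_or_pos n with rfl | hpos
    · simp
    have h1 := congrArg (MvPolynomial.aeval f) (MvPolynomial.mul_esymm_eq_sum σ F n)
    have h2 := congrArg (MvPolynomial.aeval g) (MvPolynomial.mul_esymm_eq_sum τ F n)
    simp only [map_mul, map_natCast, map_pow, map_neg, map_one, map_sum] at h1 h2
    refine mul_left_cancel₀ (Nat.cast_ne_zero.mpr hpos.ne' : (n : F) ≠ 0) ?_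
    rw [h1, h2]
    congr 1
    refine Finset.sum_congr rfl fun a ha => ?_
    obtain ⟨ha, ha'⟩ := Finset.mem_filter.mp ha
    replace ha := Finset.HasAntidiagonal.mem_antidiagonal.mp ha
    rw [ih a.1 ha' (by omega)]
    congr 1
    simpa [MvPolynomial.psum] using h a.2 (by omega)

theorem coeff_prod_X_sub_C_eq_aeval_esymm (f : σ → F) {m : ℕ} (hle : m ≤ Fintype.card σ) :
    (∏ i, (X - C (f i))).coeff m = (-1) ^ (Fintype.card σ - m) *
      MvPolynomial.aeval f (MvPolynomial.esymm σ F (Fintype.card σ - m)) := by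
  have h := Multiset.prod_X_sub_C_coeff (Finset.univ.val.map f) (k := m) (by simpa using hle)
  rw [Multiset.map_map] at h
  rw [MvPolynomial.aeval_esymm_eq_multiset_esymm]
  simpa using h

theorem roots_prod_X_sub_C_univ (f : σ → F) :
    (∏ i, (X - C (f i))).roots = Finset.univ.val.map f := by
  rw [← roots_multiset_prod_X_sub_C (Finset.univ.val.map f), Multiset.map_map]
  rfl

theorem coeff_prod_X_sub_C_eq_of_sum_pow_eq [CharZero F] {f : σ → F} {g : τ → F}
    (hcard : Fintype.card σ = Fintype.card τ)
    (h : ∀ j < Fintype.card σ, ∑ i, f i ^ j = ∑ i, g i ^ j) {m : ℕ} (hm : m ≠ 0) :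
    (∏ i, (X - C (f i))).coeff m = (∏ i, (X - C (g i))).coeff m := by
  rcases le_or_gt m (Fintype.card σ) with hle | hlt
  · rw [coeff_prod_X_sub_C_eq_aeval_esymm f hle,
      coeff_prod_X_sub_C_eq_aeval_esymm g (hcard ▸ hle), ← hcard, aeval_esymm_eq_of_sum_pow_eq h (by omega)]
  · rw [coeff_eq_zero_of_natDegree_lt (by simpa using hlt),
      coeff_eq_zero_of_natDegree_lt (by simpa [← hcard] using hlt)]

theorem coeff_zero_prod_X_sub_C_mul_sum_inv {f : σ → F} (hf : ∀ i, f i ≠ 0) :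
    (∏ i, (X - C (f i))).coeff 0 * ∑ i, (f i)⁻¹ =
      -∑ m ∈ Finset.range (Fintype.card σ),
        (∏ i, (X - C (f i))).coeff (m + 1) * ∑ i, f i ^ m := by
  set P : F[X] := ∏ i, (X - C (f i)) with hP
  have hdeg : P.natDegree < Fintype.card σ + 1 := by simp [hP]
  have heval (i : σ) : P.coeff 0 * (f i)⁻¹ +
      ∑ m ∈ Finset.range (Fintype.card σ), P.coeff (m + 1) * f i ^ m = 0 := by
    have h : P.eval (f i) = 0 := by
      rw [hP, eval_prod]
      exact Finset.prod_eq_zero (Finset.mem_univ i) (by simp)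
    rw [eval_eq_sum_range' hdeg, Finset.sum_range_succ'] at h
    have h1 := congrArg (· * (f i)⁻¹) h
    simp only [add_mul, Finset.sum_mul, zero_mul, pow_zero, mul_one] at h1
    rw [add_comm, ← h1]
    congr 1
    refine Finset.sum_congr rfl fun m _ => ?_
    rw [pow_succ, ← mul_assoc, mul_inv_cancel_right₀ (hf i)]
  have h := Finset.sum_eq_zero fun i (_ : i ∈ Finset.univ) => heval i
  rw [Finset.sum_add_distrib, ← Finset.mul_sum, Finset.sum_comm] at h
  simp only [← Finset.mul_sum] at h
  exact eq_neg_of_add_eq_zero_left h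

/-- Newton's identities determine a family of `k` nonzero scalars from its power sums of
exponents `-1, 0, …, k - 1`, as long as the sum of the inverses does not vanish. -/
theorem map_univ_eq_of_sum_pow_eq [CharZero F] {f : σ → F} {g : τ → F}
    (hf : ∀ i, f i ≠ 0) (hg : ∀ i, g i ≠ 0) (hcard : Fintype.card σ = Fintype.card τ)
    (h : ∀ j < Fintype.card σ, ∑ i, f i ^ j = ∑ i, g i ^ j)
    (hinv : ∑ i, (f i)⁻¹ = ∑ i, (g i)⁻¹) (hne : ∑ i, (f i)⁻¹ ≠ 0) :
    (Finset.univ.val.map f) = Finset.univ.val.map g := by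
  have hP : ∏ i, (X - C (f i)) = ∏ i, (X - C (g i)) := by
    ext m
    rcases Nat.eq_zero_or_pos m with rfl | hm
    · refine mul_right_cancel₀ hne ?_
      rw [coeff_zero_prod_X_sub_C_mul_sum_inv hf, hinv, coeff_zero_prod_X_sub_C_mul_sum_inv hg,
        ← hcard]
      congr 1
      refine Finset.sum_congr rfl fun m hm => ?_
      rw [coeff_prod_X_sub_C_eq_of_sum_pow_eq hcard h m.succ_ne_zero, h m (Finset.mem_range.mp hm)]
    · exact coeff_prod_X_sub_C_eq_of_sum_pow_eq hcard h hm.ne'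
  rw [← roots_prod_X_sub_C_univ f, hP, roots_prod_X_sub_C_univ g]

end PowerSums

/-- If two finite groups `G` and `H` have the same order, the same number `k` of
real-valued irreducible characters, and `s_G(n) = s_H(n)` for `n = 1, …, k+1`, then the
multisets `{χ(1)ε(χ) : χ ∈ Irr_ℝ}` of the two groups coincide. -/
theorem stmt_15 {G H : Type} [Group G] [Fintype G] [Group H] [Fintype H] (k : ℕ)
    (IrrRG : Finset (G → ℂ)) (IrrRH : Finset (H → ℂ))
    (hIrrRG : ∀ χ : G → ℂ, χ ∈ IrrRG ↔
      (∃ V : FDRep ℂ G, CategoryTheory.Simple V ∧ V.character = χ) ∧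
        ∀ g : G, ∃ r : ℝ, χ g = (r : ℂ))
    (hIrrRH : ∀ χ : H → ℂ, χ ∈ IrrRH ↔
      (∃ V : FDRep ℂ H, CategoryTheory.Simple V ∧ V.character = χ) ∧
        ∀ g : H, ∃ r : ℝ, χ g = (r : ℂ))
    (hcard : Fintype.card G = Fintype.card H)
    (hkG : IrrRG.card = k) (hkH : IrrRH.card = k)
    (hs : ∀ n : ℕ, 1 ≤ n → n ≤ k + 1 →
      Nat.card {v : Fin n → G // ((List.ofFn v).map fun g => g ^ 2).prod = 1} =
        Nat.card {v : Fin n → H // ((List.ofFn v).map fun g => g ^ 2).prod = 1}) :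
    IrrRG.val.map (fun χ => χ 1 * ((Fintype.card G : ℂ)⁻¹ * ∑ g : G, χ (g ^ 2))) =
      IrrRH.val.map (fun χ => χ 1 * ((Fintype.card H : ℂ)⁻¹ * ∑ g : H, χ (g ^ 2))) := by
  have hG0 (χ : IrrRG) : IsIrrChar.signedDegree χ.1 ≠ 0 :=
    IsIrrChar.signedDegree_ne_zero ((hIrrRG χ).mp χ.2).1 ((hIrrRG χ).mp χ.2).2
  have hH0 (χ : IrrRH) : IsIrrChar.signedDegree χ.1 ≠ 0 :=
    IsIrrChar.signedDegree_ne_zero ((hIrrRH χ).mp χ.2).1 ((hIrrRH χ).mp χ.2).2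
  have hsum (n : ℕ) (hn : n ≤ k) :
      ∑ χ : IrrRG, IsIrrChar.signedDegree χ.1 ^ 2 * (IsIrrChar.signedDegree χ.1)⁻¹ ^ (n + 1) =
      ∑ χ : IrrRH, IsIrrChar.signedDegree χ.1 ^ 2 * (IsIrrChar.signedDegree χ.1)⁻¹ ^ (n + 1) := by
    have h1 := IsIrrChar.card_mul_card_prod_sq_of_pos IrrRG hIrrRG n.succ_ne_zero
    have h2 := IsIrrChar.card_mul_card_prod_sq_of_pos IrrRH hIrrRH n.succ_ne_zero
    rw [hs (n + 1) (by omega) (by omega), hcard, h2] at h1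
    rw [← Finset.sum_coe_sort IrrRG, ← Finset.sum_coe_sort IrrRH] at h1
    exact (mul_left_cancel₀ (pow_ne_zero _ (by simp)) h1).symm
  have hne : ∑ χ : IrrRG, (IsIrrChar.signedDegree χ.1)⁻¹⁻¹ ≠ 0 := by
    have h1 := IsIrrChar.card_mul_card_prod_sq_of_pos IrrRG hIrrRG one_ne_zero
    rw [← Finset.sum_coe_sort IrrRG] at h1
    intro h0
    have h2 : ∑ χ : IrrRG, IsIrrChar.signedDegree χ.1 ^ 2 *
        (IsIrrChar.signedDegree χ.1)⁻¹ ^ 1 = 0 := by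
      rw [← h0]
      refine Finset.sum_congr rfl fun χ _ => ?_
      have := hG0 χ
      field_simp
    rw [h2, mul_zero, mul_eq_zero, Nat.cast_eq_zero, Nat.cast_eq_zero] at h1
    have : Nonempty {v : Fin 1 → G // ((List.ofFn v).map fun g => g ^ 2).prod = 1} :=
      ⟨⟨fun _ => 1, by simp⟩⟩
    exact h1.elim Fintype.card_ne_zero Nat.card_pos.ne'
  have hmap := map_univ_eq_of_sum_pow_eq
    (f := fun χ : IrrRG => (IsIrrChar.signedDegree χ.1)⁻¹)
    (g := fun χ : IrrRH => (IsIrrChar.signedDegree χ.1)⁻¹)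
    (fun χ => inv_ne_zero (hG0 χ)) (fun χ => inv_ne_zero (hH0 χ))
    (by simp [hkG, hkH])
    (fun j hj => by
      rw [Fintype.card_coe, hkG] at hj
      convert! hsum (j + 1) hj using 2 with χ _ χ _
      · have := hG0 χ
        rw [pow_add _ j 2]; field_simp
      · have := hH0 χ
        rw [pow_add _ j 2]; field_simp)
    (by
      convert! hsum 0 (Nat.zero_le k) using 2 with χ _ χ _
      · have := hG0 χ
        rw [zero_add, pow_one]; field_simp
      · have := hH0 χ
        rw [zero_add, pow_one]; field_simp)
    hne
  have hinv := congrArg (Multiset.map Inv.inv) hmap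
  simp only [Multiset.map_map, Function.comp_def, inv_inv] at hinv
  rw [Finset.univ_eq_attach, Finset.univ_eq_attach, Finset.attach_val, Finset.attach_val] at hinv
  exact (Multiset.attach_map_val' _ IsIrrChar.signedDegree).symm.trans
    (hinv.trans (Multiset.attach_map_val' _ IsIrrChar.signedDegree))
end

section
/- Let G be a finite group. The number of real conjugacy classes of G equals the number of real-valued irreducible complex characters of G. -/
open scoped ComplexOrder Matrix MonoidAlgebra
open CategoryTheory

namespace Representation

/-- Over `ℝ` or `ℂ`, characters of finite groups satisfy `χ(g⁻¹) = conj χ(g)`. -/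
theorem character_inv_eq_star_s17 {𝕜 G V : Type*} [RCLike 𝕜] [Group G] [Finite G] [AddCommGroup V]
    [Module 𝕜 V] [FiniteDimensional 𝕜 V] (ρ : Representation 𝕜 G V) (g : G) :
    ρ.character g⁻¹ = star (ρ.character g) := by
  classical
  have := Fintype.ofFinite G
  let b := Module.finBasis 𝕜 V
  let A : G →* Matrix (Fin (Module.finrank 𝕜 V)) (Fin (Module.finrank 𝕜 V)) 𝕜 :=
    (LinearMap.toMatrixAlgEquiv b : _ →* _).comp ρ
  have htr (h : G) : ρ.character h = (A h).trace := LinearMap.trace_eq_matrix_trace 𝕜 b (ρ h)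
  let P := ∑ h, (A h)ᴴ * A h
  have hP : P.PosDef := by
    have : P = 1 + ∑ h ∈ Finset.univ.erase 1, (A h)ᴴ * A h := by
      rw [show P = ∑ h, (A h)ᴴ * A h from rfl,
        ← Finset.add_sum_erase _ _ (Finset.mem_univ (1 : G))]
      simp
    rw [this]
    exact Matrix.PosDef.one.add_posSemidef
      (Matrix.posSemidef_sum _ fun h _ ↦ Matrix.posSemidef_conjTranspose_mul_self (A h))
  have hinv : (A g)ᴴ * P * A g = P := by
    simp only [P, Finset.mul_sum, Finset.sum_mul]
    refine Fintype.sum_equiv (Equiv.mulRight g) _ _ fun h ↦ ?_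
    simp [Matrix.mul_assoc]
  have hcomm : (A g)ᴴ * P = P * A g⁻¹ := by
    rw [← hinv, Matrix.mul_assoc _ (A g), ← map_mul]
    simp [hinv]
  have hdet := (Matrix.isUnit_iff_isUnit_det _).1 hP.isUnit
  rw [htr, htr, ← Matrix.trace_conjTranspose, ← Matrix.mul_nonsing_inv_cancel_right _ (A g)ᴴ hdet,
    hcomm, Matrix.trace_mul_comm, Matrix.nonsing_inv_mul_cancel_left _ _ hdet]

variable {k G V : Type*} [Field k] [Group G] [Fintype G] [AddCommGroup V] [Module k V]

/-- A class function orthogonal to the character of an irreducible representation acts on it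
as zero. -/
theorem sum_smul_eq_zero_of_orthogonal_s17 [IsAlgClosed k] [CharZero k] [FiniteDimensional k V]
    (ρ : Representation k G V) [ρ.IsIrreducible] {f : G → k}
    (hf : ∀ g h, f (h * g * h⁻¹) = f g) (horth : ∑ g, f g * ρ.character g = 0) :
    ∑ g, f g • ρ g = 0 := by
  let φ : IntertwiningMap ρ ρ := ⟨∑ g, f g • ρ g, fun h ↦ by
    simp only [← Module.End.mul_eq_comp, Finset.mul_sum, Finset.sum_mul]
    refine Fintype.sum_equiv (MulAut.conj h).symm.toEquiv _ _ fun g ↦ ?_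
    have : f (h⁻¹ * (g * h)) = f g := by simpa [mul_assoc] using hf g h⁻¹
    simp [this, ← map_mul, mul_assoc]⟩
  obtain ⟨c, hc⟩ := (IsIrreducible.algebraMap_intertwiningMap_bijective_of_isAlgClosed (ρ := ρ)).2 φ
  have hc' : ∑ g, f g • ρ g = c • LinearMap.id :=
    congr(IntertwiningMap.toLinearMap $hc).symm
  have htr := congr(LinearMap.trace k V $hc')
  have hV : Nontrivial V := by
    have := (irreducible_iff_isSimpleModule_asModule ρ).1 inferInstance
    exact IsSimpleModule.nontrivial k[G] ρ.asModule
  simp only [map_sum, map_smul, smul_eq_mul, LinearMap.trace_id] at htr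
  change ∑ g, f g * ρ.character g = _ at htr
  rw [horth, eq_comm, mul_eq_zero, Nat.cast_eq_zero] at htr
  rw [hc', htr.resolve_right Module.finrank_pos.ne', zero_smul]

/-- The characters of irreducible representations separate class functions from zero. -/
theorem eq_zero_of_forall_orthogonal {k G : Type} [Field k] [Group G] [Fintype G] [IsAlgClosed k]
    [CharZero k] {f : G → k} (hf : ∀ g h, f (h * g * h⁻¹) = f g)
    (horth : ∀ V : FDRep k G, Simple V → ∑ g, f g * V.character g = 0) : f = 0 := by
  have := invertibleOfNonzero (NeZero.ne (Nat.card G : k))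
  let z : k[G] := ∑ g, MonoidAlgebra.single g (f g)
  have hz (r : k[G]) : z * r = r * z := by
    induction r using MonoidAlgebra.induction_on with
    | of h =>
      simp only [z, Finset.mul_sum, Finset.sum_mul]
      refine Fintype.sum_equiv (MulAut.conj h).symm.toEquiv _ _ fun g ↦ ?_
      have : f (h⁻¹ * (g * h)) = f g := by simpa [mul_assoc] using hf g h⁻¹
      simp [this, mul_assoc]
    | add x y hx hy => rw [mul_add, add_mul, hx, hy]
    | smul r x hx => rw [mul_smul_comm, smul_mul_assoc, hx]
  let N : Submodule k[G] k[G] :=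
    { carrier := {m | z * m = 0}
      zero_mem' := mul_zero z
      add_mem' := fun {a b} ha hb ↦ by
        simp only [Set.mem_ofPred_eq] at *
        rw [mul_add, ha, hb, add_zero]
      smul_mem' := fun r m hm ↦ by
        simp only [Set.mem_ofPred_eq, smul_eq_mul] at *
        rw [← mul_assoc, hz, mul_assoc, hm, mul_zero] }
  have hN : N = ⊤ := by
    rw [eq_top_iff, ← IsSemisimpleModule.sSup_simples_eq_top k[G] k[G], sSup_le_iff]
    intro S hS m hm
    have hS : IsSimpleModule k[G] S := hS
    let ρ : Representation k G S := ofModule' S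
    have hρ : ρ.asAlgebraHom = Algebra.lsmul k k S := (MonoidAlgebra.lift k _ G).apply_symm_apply _
    let e : ρ.asModule ≃ₗ[k[G]] S :=
      { ρ.asModuleEquiv with
        map_smul' := fun r x ↦ congr($hρ r (ρ.asModuleEquiv x)) }
    have : ρ.IsIrreducible := (irreducible_iff_isSimpleModule_asModule ρ).2 (.congr e)
    have : FiniteDimensional k S :=
      inferInstanceAs (FiniteDimensional k (S.restrictScalars k))
    have hsimple : Simple (FDRep.of ρ) := by
      rw [FDRep.simple_iff_char_is_norm_one]
      have h := char_orthonormal ρ ρ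
      rw [if_pos ⟨Equiv.refl ρ⟩, inv_mul_eq_one₀ (NeZero.ne _)] at h
      exact h.symm
    have h0 := sum_smul_eq_zero_of_orthogonal_s17 ρ hf (horth _ hsimple)
    have h1 : ρ.asAlgebraHom z = ∑ g, f g • ρ g := by simp [z]
    have h2 := congr(($h1 ⟨m, hm⟩ : k[G]))
    rw [h0, hρ] at h2
    exact h2
  have hz0 : z = 0 := by
    have : (1 : k[G]) ∈ N := hN ▸ Submodule.mem_top
    simpa [N] using this
  ext g
  classical
  have := congr(($hz0).coeff g)
  simpa [z, MonoidAlgebra.coeff_sum, Finsupp.single_apply] using this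

end Representation

namespace FDRep

/-- The characters of the irreducible representations of `G` over `k`. -/
def irreducibleCharacters (k G : Type) [Field k] [Group G] : Set (G → k) :=
  {χ | ∃ V : FDRep k G, Simple V ∧ V.character = χ}

variable {k G : Type} [Field k] [Group G]

theorem apply_conj_of_mem_irreducibleCharacters {χ : G → k} (hχ : χ ∈ irreducibleCharacters k G)
    (g h : G) : χ (h * g * h⁻¹) = χ g := by
  obtain ⟨V, -, rfl⟩ := hχ
  exact V.char_conj g h

variable [Fintype G] [IsAlgClosed k] [CharZero k]

open scoped Classical in
theorem sum_mul_inv_of_mem_irreducibleCharacters {χ ψ : G → k}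
    (hχ : χ ∈ irreducibleCharacters k G) (hψ : ψ ∈ irreducibleCharacters k G) :
    (Nat.card G : k)⁻¹ * ∑ g, χ g * ψ g⁻¹ = if χ = ψ then 1 else 0 := by
  have := invertibleOfNonzero (NeZero.ne (Nat.card G : k))
  obtain ⟨V, hV, rfl⟩ := hχ
  obtain ⟨W, hW, rfl⟩ := hψ
  split_ifs with h
  · rw [← h, char_orthonormal, if_pos ⟨Iso.refl V⟩]
  · rw [char_orthonormal, if_neg fun ⟨i⟩ ↦ h (char_iso i)]

theorem comp_inv_mem_irreducibleCharacters {χ : G → k} (hχ : χ ∈ irreducibleCharacters k G) :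
    (fun g ↦ χ g⁻¹) ∈ irreducibleCharacters k G := by
  obtain ⟨V, hV, rfl⟩ := hχ
  refine ⟨of (Representation.dual V.ρ), ?_, funext (char_dual V)⟩
  rw [simple_iff_char_is_norm_one] at hV ⊢
  simpa [mul_comm] using hV

theorem finite_irreducibleCharacters : (irreducibleCharacters k G).Finite := by
  classical
  suffices LinearIndependent k (fun χ : irreducibleCharacters k G ↦ χ.1) from this.setFinite
  rw [linearIndependent_iff']
  intro s c hc ψ hψ
  have h : ∑ χ ∈ s, c χ * ((Nat.card G : k)⁻¹ * ∑ g, χ.1 g * ψ.1 g⁻¹) = 0 := by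
    simp only [Finset.mul_sum]
    rw [Finset.sum_comm]
    refine Finset.sum_eq_zero fun g _ ↦ ?_
    have := congr((Nat.card G : k)⁻¹ * $hc g * ψ.1 g⁻¹)
    simp only [Finset.sum_apply, Pi.smul_apply, smul_eq_mul, Pi.zero_apply, Finset.mul_sum,
      Finset.sum_mul, mul_zero, zero_mul] at this
    rw [← this]
    exact Finset.sum_congr rfl fun χ _ ↦ by ring
  simp_rw [fun χ : irreducibleCharacters k G ↦
    sum_mul_inv_of_mem_irreducibleCharacters χ.2 ψ.2] at h
  simpa [Subtype.coe_inj, hψ] using h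

/-- The expansion of a class function in terms of irreducible characters. -/
theorem sum_irreducibleCharacters_eq {f : G → k} (hf : ∀ g h, f (h * g * h⁻¹) = f g) (g : G) :
    ∑ χ ∈ (finite_irreducibleCharacters (k := k) (G := G)).toFinset,
      ((Nat.card G : k)⁻¹ * ∑ x, f x * χ x⁻¹) * χ g = f g := by
  classical
  set s := (finite_irreducibleCharacters (k := k) (G := G)).toFinset with hs
  have hmem {χ} : χ ∈ s ↔ χ ∈ irreducibleCharacters k G := by simp [hs]
  let c (χ : G → k) : k := (Nat.card G : k)⁻¹ * ∑ x, f x * χ x⁻¹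
  suffices (fun g ↦ f g - ∑ χ ∈ s, c χ * χ g) = 0 from (sub_eq_zero.1 (congrFun this g)).symm
  refine Representation.eq_zero_of_forall_orthogonal (fun g h ↦ ?_) fun V hV ↦ ?_
  · rw [hf]
    congr 1
    refine Finset.sum_congr rfl fun χ hχ ↦ ?_
    rw [apply_conj_of_mem_irreducibleCharacters (hmem.1 hχ)]
  · have hV' : V.character ∈ irreducibleCharacters k G := ⟨V, hV, rfl⟩
    have hψ := comp_inv_mem_irreducibleCharacters hV'
    set ψ : G → k := fun g ↦ V.character g⁻¹
    have hψV (g : G) : V.character g = ψ g⁻¹ := by simp [ψ]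
    have h : ∑ χ ∈ s, c χ * ((Nat.card G : k)⁻¹ * ∑ g, χ g * ψ g⁻¹) = c ψ := by
      rw [Finset.sum_congr rfl fun χ hχ ↦ by
        rw [sum_mul_inv_of_mem_irreducibleCharacters (hmem.1 hχ) hψ]]
      simp [hmem.2 hψ]
    refine (mul_eq_zero.1 ?_).resolve_left (inv_ne_zero (NeZero.ne (Nat.card G : k)))
    simp only [hψV, sub_mul, Finset.sum_sub_distrib, mul_sub]
    rw [sub_eq_zero]
    change c ψ = _
    rw [← h]
    simp only [Finset.mul_sum, Finset.sum_mul]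
    rw [Finset.sum_comm]
    exact Finset.sum_congr rfl fun _ _ ↦ Finset.sum_congr rfl fun _ _ ↦ by ring

open scoped Classical in
/-- Column orthogonality of irreducible characters. -/
theorem card_conj_mul_sum_irreducibleCharacters (g h : G) :
    (Finset.card {x | ConjClasses.mk x = ConjClasses.mk h} : k) *
      ∑ χ ∈ (finite_irreducibleCharacters (k := k) (G := G)).toFinset,
        (Nat.card G : k)⁻¹ * (χ h⁻¹ * χ g) =
      if ConjClasses.mk g = ConjClasses.mk h then 1 else 0 := by
  have hconj (x y : G) : ConjClasses.mk (y * x * y⁻¹) = ConjClasses.mk x :=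
    (ConjClasses.mk_eq_mk_iff_isConj.2 (isConj_iff.2 ⟨y, rfl⟩)).symm
  rw [← sum_irreducibleCharacters_eq
    (f := fun x ↦ if ConjClasses.mk x = ConjClasses.mk h then (1 : k) else 0)
    (fun x y ↦ by simp only [hconj]), Finset.mul_sum]
  refine Finset.sum_congr rfl fun χ hχ ↦ ?_
  have hχ : χ ∈ irreducibleCharacters k G := by simpa using hχ
  have hsum : ∑ x, (if ConjClasses.mk x = ConjClasses.mk h then (1 : k) else 0) * χ x⁻¹ =
      (Finset.card {x | ConjClasses.mk x = ConjClasses.mk h} : k) * χ h⁻¹ := by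
    simp only [ite_mul, one_mul, zero_mul]
    rw [← Finset.sum_filter, ← nsmul_eq_mul]
    refine Finset.sum_eq_card_nsmul fun x hx ↦ ?_
    obtain ⟨y, rfl⟩ := isConj_iff.1 (ConjClasses.mk_eq_mk_iff_isConj.1 (Finset.mem_filter.1 hx).2)
    rw [← apply_conj_of_mem_irreducibleCharacters hχ x⁻¹ y]
    simp [mul_assoc]
  rw [hsum]
  ring

omit [IsAlgClosed k] [CharZero k] [Fintype G] in
/-- A complex character is real-valued if and only if it is invariant under inversion. -/
theorem forall_real_iff_comp_inv_eq [Finite G] {χ : G → ℂ} (hχ : χ ∈ irreducibleCharacters ℂ G) :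
    (∀ g, ∃ r : ℝ, χ g = r) ↔ χ = fun g ↦ χ g⁻¹ := by
  obtain ⟨V, -, rfl⟩ := hχ
  rw [funext_iff]
  refine forall_congr' fun g ↦ ?_
  have h : V.character g⁻¹ = star (V.character g) :=
    Representation.character_inv_eq_star_s17 V.ρ g
  rw [h, ← Complex.conj_eq_iff_real]
  exact eq_comm

end FDRep

theorem ConjClasses.carrier_inv_eq_iff {G : Type*} [Group G] (g : G) :
    (ConjClasses.mk g).carrier⁻¹ = (ConjClasses.mk g).carrier ↔
      ConjClasses.mk g⁻¹ = ConjClasses.mk g := by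
  constructor
  · intro h
    rw [← ConjClasses.mem_carrier_iff_mk_eq, ← Set.mem_inv, h]
    exact ConjClasses.mem_carrier_mk
  · intro h
    ext x
    rw [Set.mem_inv, ConjClasses.mem_carrier_iff_mk_eq, ConjClasses.mem_carrier_iff_mk_eq]
    conv_lhs => rw [← h]
    simp only [ConjClasses.mk_eq_mk_iff_isConj, isConj_iff]
    refine exists_congr fun y ↦ ?_
    rw [← inv_inj]
    simp [mul_assoc]

/-- The number of real conjugacy classes of `G` equals the number of real-valued
irreducible complex characters of `G`. -/
theorem stmt_17 {G : Type} [Group G] [Fintype G] (IrrR : Finset (G → ℂ))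
    (hIrrR : ∀ χ : G → ℂ, χ ∈ IrrR ↔
      (∃ V : FDRep ℂ G, CategoryTheory.Simple V ∧ V.character = χ) ∧
        ∀ g : G, ∃ r : ℝ, χ g = (r : ℂ)) :
    Nat.card {c : ConjClasses G // c.carrier⁻¹ = c.carrier} = IrrR.card := by
  classical
  set s := (FDRep.finite_irreducibleCharacters (k := ℂ) (G := G)).toFinset with hs
  have hmem {χ} : χ ∈ s ↔ χ ∈ FDRep.irreducibleCharacters ℂ G := by simp [hs]
  have hIrr : IrrR = s.filter fun χ ↦ χ = fun g ↦ χ g⁻¹ := by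
    ext χ
    rw [hIrrR, Finset.mem_filter, hmem]
    exact and_congr_right FDRep.forall_real_iff_comp_inv_eq
  have hcol (h : G) : ∑ χ ∈ s, (Nat.card G : ℂ)⁻¹ * (χ h⁻¹ * χ h⁻¹) =
      if (ConjClasses.mk h).carrier⁻¹ = (ConjClasses.mk h).carrier then
        (Finset.card {x : G | ConjClasses.mk x = ConjClasses.mk h} : ℂ)⁻¹ else 0 := by
    have hne : (Finset.card {x : G | ConjClasses.mk x = ConjClasses.mk h} : ℂ) ≠ 0 :=
      Nat.cast_ne_zero.2 (Finset.card_ne_zero_of_mem (a := h) (by simp))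
    have := FDRep.card_conj_mul_sum_irreducibleCharacters (k := ℂ) h⁻¹ h
    rw [eq_comm, ← inv_mul_eq_iff_eq_mul₀ hne] at this
    rw [← this]
    simp [ConjClasses.carrier_inv_eq_iff]
  rw [Nat.card_eq_fintype_card, Fintype.card_subtype, hIrr, ← Nat.cast_inj (R := ℂ)]
  symm
  calc ((s.filter fun χ ↦ χ = fun g ↦ χ g⁻¹).card : ℂ)
    _ = ∑ χ ∈ s, (Nat.card G : ℂ)⁻¹ * ∑ g, χ g * χ g := by
      rw [Finset.card_filter, Nat.cast_sum]
      refine Finset.sum_congr rfl fun χ hχ ↦ ?_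
      have := FDRep.sum_mul_inv_of_mem_irreducibleCharacters (hmem.1 hχ)
        (FDRep.comp_inv_mem_irreducibleCharacters (hmem.1 hχ))
      simp only [inv_inv] at this
      rw [this, Nat.cast_ite, Nat.cast_one, Nat.cast_zero]
    _ = ∑ g, ∑ χ ∈ s, (Nat.card G : ℂ)⁻¹ * (χ g⁻¹ * χ g⁻¹) := by
      rw [Finset.sum_comm]
      refine Finset.sum_congr rfl fun χ _ ↦ ?_
      rw [Finset.mul_sum]
      exact (Equiv.sum_comp (Equiv.inv G) fun g ↦ (Nat.card G : ℂ)⁻¹ * (χ g * χ g)).symm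
    _ = ∑ c : ConjClasses G, if c.carrier⁻¹ = c.carrier then 1 else 0 := by
      rw [← Finset.sum_fiberwise Finset.univ ConjClasses.mk]
      refine Finset.sum_congr rfl fun c _ ↦ ?_
      obtain ⟨h, rfl⟩ := ConjClasses.mk_surjective c
      have hne : (Finset.card {x : G | ConjClasses.mk x = ConjClasses.mk h} : ℂ) ≠ 0 :=
        Nat.cast_ne_zero.2 (Finset.card_ne_zero_of_mem (a := h) (by simp))
      rw [Finset.sum_congr rfl fun x hx ↦ by rw [hcol, (Finset.mem_filter.1 hx).2]]
      simp [hne]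
    _ = _ := by rw [Finset.card_filter, Nat.cast_sum]; simp
end
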